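/- arXiv:2401.03161 — 3 statements merged into one kernel-verified Lean document; each statement's English description precedes it below -/
import Mathlib

section
/- Relative entropy inequality (inequality part of Theorem 3.1). Let (n, n₊, n₋) be a nonnegative classical solution of the CRTM on [0,∞), let (m, m₊, m₋) be a positive stationary state, define the relative gaps ω, ω₊, ω₋, ω₊L, ω₋L as above, and let H ∈ C²(ℝ) be convex. Then each of the seven dissipation functionals is nonpositive: D1(t) ≤ 0, D1₊(t) ≤ 0, D1₋(t) ≤ 0, D2₊(t) ≤ 0, D2₋(t) ≤ 0, D3₊(t) ≤ 0, D3₋(t) ≤ 0 for all t ≥ 0; consequently the relative entropy t ↦ ∫_{−L}^{L}∫_{−π}^{π} m H(ω) dθ dy + ∫_0^{π} m₊ H(ω₊) dθ + ∫_{−π}^{0} m₋ H(ω₋) dθ is nonincreasing in t. -/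
open MeasureTheory Real Set

noncomputable section

/-- A classical solution of the confined run-and-tumble model (CRTM) on `[0,∞)`. -/
structure IsCRTMSolution (V L : ℝ)
    (K : ℝ → ℝ → ℝ → ℝ) (Kp : ℝ → ℝ → ℝ) (Km : ℝ → ℝ → ℝ)
    (n : ℝ → ℝ → ℝ → ℝ) (np : ℝ → ℝ → ℝ) (nm : ℝ → ℝ → ℝ) : Prop where
  smooth_n : ContDiff ℝ 1 (fun p : ℝ × ℝ × ℝ => n p.1 p.2.1 p.2.2)
  smooth_np : ContDiff ℝ 1 (fun p : ℝ × ℝ => np p.1 p.2)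
  smooth_nm : ContDiff ℝ 1 (fun p : ℝ × ℝ => nm p.1 p.2)
  interior_eq : ∀ t ≥ (0:ℝ), ∀ y ∈ Ioo (-L) L, ∀ θ ∈ Ioo (-π) π,
    deriv (fun s => n s y θ) t + V * sin θ * deriv (fun z => n t z θ) y
      + (∫ θ' in (-π)..π, K y θ (θ' - θ)) * n t y θ
      = ∫ θ' in (-π)..π, K y θ' (θ - θ') * n t y θ'
  top_eq : ∀ t ≥ (0:ℝ), ∀ θ ∈ Ioo (0:ℝ) π,
    deriv (fun s => np s θ) t + (∫ θ' in (-π)..π, Kp θ (θ' - θ)) * np t θ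
      = (∫ θ' in (0:ℝ)..π, Kp θ' (θ - θ') * np t θ') + V * sin θ * n t L θ
  bot_eq : ∀ t ≥ (0:ℝ), ∀ θ ∈ Ioo (-π) (0:ℝ),
    deriv (fun s => nm s θ) t + (∫ θ' in (-π)..π, Km θ (θ' - θ)) * nm t θ
      = (∫ θ' in (-π)..(0:ℝ), Km θ' (θ - θ') * nm t θ') - V * sin θ * n t (-L) θ
  bc_periodic : ∀ t ≥ (0:ℝ), ∀ y ∈ Icc (-L) L, n t y (-π) = n t y π
  bc_top : ∀ t ≥ (0:ℝ), ∀ θ ∈ Ioo (-π) (0:ℝ),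
    -(V * sin θ * n t L θ) = ∫ θ' in (0:ℝ)..π, Kp θ' (θ - θ') * np t θ'
  bc_bot : ∀ t ≥ (0:ℝ), ∀ θ ∈ Ioo (0:ℝ) π,
    V * sin θ * n t (-L) θ = ∫ θ' in (-π)..(0:ℝ), Km θ' (θ - θ') * nm t θ'

/-- Interior dissipation `D_H^{(1)}(t)`. -/
def D1 (L : ℝ) (K : ℝ → ℝ → ℝ → ℝ) (m : ℝ → ℝ → ℝ) (H : ℝ → ℝ)
    (ω : ℝ → ℝ → ℝ → ℝ) (t : ℝ) : ℝ :=
  -∫ y in (-L)..L, ∫ θ in (-π)..π, ∫ θ' in (-π)..π,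
    K y θ' (θ - θ') * m y θ' *
      (H (ω t y θ') - H (ω t y θ) - deriv H (ω t y θ) * (ω t y θ' - ω t y θ))

/-- Upper-boundary dissipation `D_{H,+}^{(1)}(t)`. -/
def D1p (Kp : ℝ → ℝ → ℝ) (mp : ℝ → ℝ) (H : ℝ → ℝ) (ωp : ℝ → ℝ → ℝ) (t : ℝ) : ℝ :=
  -∫ θ in (0:ℝ)..π, ∫ θ' in (0:ℝ)..π,
    Kp θ' (θ - θ') * mp θ' *
      (H (ωp t θ') - H (ωp t θ) - deriv H (ωp t θ) * (ωp t θ' - ωp t θ))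

/-- Lower-boundary dissipation `D_{H,−}^{(1)}(t)`. -/
def D1m (Km : ℝ → ℝ → ℝ) (mm : ℝ → ℝ) (H : ℝ → ℝ) (ωm : ℝ → ℝ → ℝ) (t : ℝ) : ℝ :=
  -∫ θ in (-π)..(0:ℝ), ∫ θ' in (-π)..(0:ℝ),
    Km θ' (θ - θ') * mm θ' *
      (H (ωm t θ') - H (ωm t θ) - deriv H (ωm t θ) * (ωm t θ' - ωm t θ))

/-- Dissipation `D_{H,+}^{(2)}(t)` of the state transition interior → upper boundary. -/
def D2p (V : ℝ) (mL : ℝ → ℝ) (H : ℝ → ℝ) (ωpL ωp : ℝ → ℝ → ℝ) (t : ℝ) : ℝ :=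
  -∫ θ in (0:ℝ)..π, V * sin θ * mL θ *
      (H (ωpL t θ) - H (ωp t θ) - deriv H (ωp t θ) * (ωpL t θ - ωp t θ))

/-- Dissipation `D_{H,−}^{(2)}(t)` of the state transition interior → lower boundary. -/
def D2m (V : ℝ) (mmL : ℝ → ℝ) (H : ℝ → ℝ) (ωmL ωm : ℝ → ℝ → ℝ) (t : ℝ) : ℝ :=
  ∫ θ in (-π)..(0:ℝ), V * sin θ * mmL θ *
      (H (ωmL t θ) - H (ωm t θ) - deriv H (ωm t θ) * (ωmL t θ - ωm t θ))

/-- Dissipation `D_{H,+}^{(3)}(t)` of the state transition upper boundary → interior. -/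
def D3p (Kp : ℝ → ℝ → ℝ) (mp : ℝ → ℝ) (H : ℝ → ℝ) (ωp ωpL : ℝ → ℝ → ℝ) (t : ℝ) : ℝ :=
  -∫ θ in (-π)..(0:ℝ), ∫ θ' in (0:ℝ)..π,
    Kp θ' (θ - θ') * mp θ' *
      (H (ωp t θ') - H (ωpL t θ) - deriv H (ωpL t θ) * (ωp t θ' - ωpL t θ))

/-- Dissipation `D_{H,−}^{(3)}(t)` of the state transition lower boundary → interior. -/
def D3m (Km : ℝ → ℝ → ℝ) (mm : ℝ → ℝ) (H : ℝ → ℝ) (ωm ωmL : ℝ → ℝ → ℝ) (t : ℝ) : ℝ :=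
  -∫ θ in (0:ℝ)..π, ∫ θ' in (-π)..(0:ℝ),
    Km θ' (θ - θ') * mm θ' *
      (H (ωm t θ') - H (ωmL t θ) - deriv H (ωmL t θ) * (ωm t θ' - ωmL t θ))

lemma crtm_tangent {H : ℝ → ℝ} (hH : ContDiff ℝ 2 H) (hc : ConvexOn ℝ univ H) (a b : ℝ) :
    0 ≤ H b - H a - deriv H a * (b - a) := by
  have hd : DifferentiableAt ℝ H a := (hH.differentiable (by norm_num)) a
  rcases lt_trichotomy a b with h | h | h
  · have := hc.deriv_le_slope (mem_univ a) (mem_univ b) h hd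
    rw [slope_def_field, le_div_iff₀ (by linarith)] at this
    linarith
  · subst h; simp
  · have := hc.slope_le_deriv (mem_univ b) (mem_univ a) h hd
    rw [slope_def_field, div_le_iff₀ (by linarith)] at this
    linarith

lemma crtm_jensen {H : ℝ → ℝ} (hH : ContDiff ℝ 2 H) (hc : ConvexOn ℝ univ H) {a b : ℝ}
    (hab : a ≤ b) {k N M : ℝ → ℝ} (hk : Continuous k) (hN : Continuous N) (hM : Continuous M)
    (hk0 : ∀ x, 0 ≤ k x) (hM0 : ∀ x, 0 < M x) (w : ℝ) :
    deriv H w * ((∫ x in a..b, k x * N x) - w * ∫ x in a..b, k x * M x)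
      ≤ (∫ x in a..b, k x * (M x * H (N x / M x))) - H w * ∫ x in a..b, k x * M x := by
  have hHc : Continuous H := hH.continuous
  have hq : Continuous fun x => N x / M x := hN.div hM (fun x => (hM0 x).ne')
  have h1 : 0 ≤ ∫ x in a..b, (k x * (M x * H (N x / M x)) - H w * (k x * M x)
      - deriv H w * (k x * N x - w * (k x * M x))) := by
    apply intervalIntegral.integral_nonneg hab
    intro x _
    have h2 := crtm_tangent hH hc w (N x / M x)
    have h3 := mul_nonneg (mul_nonneg (hk0 x) (hM0 x).le) h2
    have h4 : N x = N x / M x * M x := by field_simp [(hM0 x).ne']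
    have h5 : k x * (M x * H (N x / M x)) - H w * (k x * M x)
      - deriv H w * (k x * N x - w * (k x * M x)) = 
      k x * M x * (H (N x / M x) - H w - deriv H w * (N x / M x - w)) := by
      conv_lhs => rw [show k x * N x = k x * (N x / M x * M x) by rw [← h4]]
      ring
    rw [h5]; exact h3
  rw [intervalIntegral.integral_sub, intervalIntegral.integral_sub,
    intervalIntegral.integral_const_mul, intervalIntegral.integral_const_mul,
    intervalIntegral.integral_sub, intervalIntegral.integral_const_mul] at h1
  · linarith
  all_goals exact Continuous.intervalIntegrable (by fun_prop) _ _

lemma crtm_swap {F : ℝ → ℝ → ℝ} (hF : Continuous fun p : ℝ × ℝ => F p.1 p.2) (a b c d : ℝ) :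
    ∫ x in a..b, ∫ y in c..d, F x y = ∫ y in c..d, ∫ x in a..b, F x y := by
  apply intervalIntegral_intervalIntegral_swap
  refine (ContinuousOn.integrableOn_compact (isCompact_uIcc.prod isCompact_uIcc) 
    (K := uIcc a b ×ˢ uIcc c d) ?_).mono_set (prod_mono uIoc_subset_uIcc uIoc_subset_uIcc)
  exact hF.continuousOn

lemma crtm_mass {k : ℝ → ℝ → ℝ} {u : ℝ → ℝ} (hk : Continuous fun p : ℝ × ℝ => k p.1 p.2)
    (hu : Continuous u) (a b : ℝ) :
    ∫ θ in a..b, (∫ θ' in (-π)..π, k θ (θ' - θ)) * u θ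
      = ∫ θ in (-π)..π, ∫ θ' in a..b, k θ' (θ - θ') * u θ' := by
  simp_rw [← intervalIntegral.integral_mul_const]
  apply crtm_swap (F := fun x y => k x (y - x) * u x)
  have : Continuous fun p : ℝ × ℝ => k p.1 (p.2 - p.1) := 
    hk.comp (g := fun p : ℝ × ℝ => k p.1 p.2) (f := fun p : ℝ × ℝ => (p.1, p.2 - p.1)) (by fun_prop)
  fun_prop

lemma crtm_param {X : Type*} [TopologicalSpace X] {F : X → ℝ → ℝ}
    (hF : Continuous fun p : X × ℝ => F p.1 p.2) (a b : ℝ) :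
    Continuous fun x => ∫ y in a..b, F x y :=
  intervalIntegral.continuous_parametric_intervalIntegral_of_continuous' hF a b

lemma crtm_deriv_int {F F' : ℝ → ℝ → ℝ} (hF : Continuous fun p : ℝ × ℝ => F p.1 p.2)
    (hF' : Continuous fun p : ℝ × ℝ => F' p.1 p.2)
    (hd : ∀ t x, HasDerivAt (fun s => F s x) (F' t x) t) (a b t : ℝ) :
    HasDerivAt (fun s => ∫ x in a..b, F s x) (∫ x in a..b, F' t x) t := by
  obtain ⟨C, hC⟩ := ((isCompact_Icc (a := t - 1) (b := t + 1)).prod 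
    (isCompact_uIcc (a := a) (b := b))).exists_bound_of_continuousOn hF'.continuousOn
  have h1 : ∀ s, Continuous (F s) := fun s => hF.comp (f := fun x : ℝ => (s, x)) (by fun_prop)
  have h2 : ∀ s, Continuous (F' s) := fun s => hF'.comp (f := fun x : ℝ => (s, x)) (by fun_prop)
  refine (intervalIntegral.hasDerivAt_integral_of_dominated_loc_of_deriv_le (bound := fun _ => C)
    (Icc_mem_nhds (show t - 1 < t by linarith) (show t < t + 1 by linarith))
    (Filter.Eventually.of_forall fun s => (h1 s).aestronglyMeasurable)
    ((h1 t).intervalIntegrable _ _) (h2 t).aestronglyMeasurable 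
    (Filter.Eventually.of_forall ?_) (by simp) (Filter.Eventually.of_forall ?_)).2
  · intro x hx s hs
    exact hC (s, x) ⟨hs, uIoc_subset_uIcc hx⟩
  · intro x hx s hs
    exact hd s x

lemma crtm_deriv_int2 {F F' : ℝ → ℝ → ℝ → ℝ} 
    (hF : Continuous fun p : ℝ × ℝ × ℝ => F p.1 p.2.1 p.2.2)
    (hF' : Continuous fun p : ℝ × ℝ × ℝ => F' p.1 p.2.1 p.2.2)
    (hd : ∀ t y x, HasDerivAt (fun s => F s y x) (F' t y x) t) (a b c d t : ℝ) :
    HasDerivAt (fun s => ∫ y in a..b, ∫ x in c..d, F s y x) 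
      (∫ y in a..b, ∫ x in c..d, F' t y x) t := by
  apply crtm_deriv_int (F := fun s y => ∫ x in c..d, F s y x) 
    (F' := fun s y => ∫ x in c..d, F' s y x)
  · apply crtm_param (F := fun (p : ℝ × ℝ) x => F p.1 p.2 x)
    exact hF.comp (f := fun p : (ℝ × ℝ) × ℝ => (p.1.1, p.1.2, p.2)) (by fun_prop)
  · apply crtm_param (F := fun (p : ℝ × ℝ) x => F' p.1 p.2 x)
    exact hF'.comp (f := fun p : (ℝ × ℝ) × ℝ => (p.1.1, p.1.2, p.2)) (by fun_prop)
  · intro s y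
    apply crtm_deriv_int (F := fun s x => F s y x) (F' := fun s x => F' s y x)
    · exact hF.comp (f := fun p : ℝ × ℝ => (p.1, y, p.2)) (by fun_prop)
    · exact hF'.comp (f := fun p : ℝ × ℝ => (p.1, y, p.2)) (by fun_prop)
    · intro t x; exact hd t y x

/-- boundary balance: subsolution of a boundary equation. -/
lemma crtm_bdry {k : ℝ → ℝ → ℝ} {u ut c : ℝ → ℝ} (hk : Continuous fun p : ℝ × ℝ => k p.1 p.2)
    (hu : Continuous u) (hut : Continuous ut) (hc : Continuous c) {a b : ℝ} (hab : a ≤ b)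
    (h : ∀ θ ∈ Ioo a b, ut θ ≤ (∫ θ' in a..b, k θ' (θ - θ') * u θ') + c θ 
      - (∫ θ' in (-π)..π, k θ (θ' - θ)) * u θ) :
    ∫ θ in a..b, ut θ ≤ (∫ θ in a..b, ∫ θ' in a..b, k θ' (θ - θ') * u θ') + (∫ θ in a..b, c θ)
      - ∫ θ in (-π)..π, ∫ θ' in a..b, k θ' (θ - θ') * u θ' := by
  have hG : Continuous fun θ => ∫ θ' in a..b, k θ' (θ - θ') * u θ' := by
    apply crtm_param (F := fun θ θ' => k θ' (θ - θ') * u θ')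
    have : Continuous fun p : ℝ × ℝ => k p.2 (p.1 - p.2) := 
      hk.comp (f := fun p : ℝ × ℝ => (p.2, p.1 - p.2)) (by fun_prop)
    fun_prop
  have hk2 : Continuous fun θ => ∫ θ' in (-π)..π, k θ (θ' - θ) := by
    apply crtm_param (F := fun θ θ' => k θ (θ' - θ))
    exact hk.comp (f := fun p : ℝ × ℝ => (p.1, p.2 - p.1)) (by fun_prop)
  rw [← crtm_mass hk hu]
  rw [← intervalIntegral.integral_add, ← intervalIntegral.integral_sub]
  · apply intervalIntegral.integral_mono_on_of_le_Ioo hab _ _ h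
    all_goals exact Continuous.intervalIntegrable (by fun_prop) _ _
  all_goals exact Continuous.intervalIntegrable (by fun_prop) _ _

/-- The linear balance for subsolutions. -/
lemma crtm_balance {V L : ℝ} (hL : 0 < L)
    {K : ℝ → ℝ → ℝ → ℝ} {Kp : ℝ → ℝ → ℝ} {Km : ℝ → ℝ → ℝ}
    (hKc : Continuous (fun p : ℝ × ℝ × ℝ => K p.1 p.2.1 p.2.2))
    (hKpc : Continuous (fun p : ℝ × ℝ => Kp p.1 p.2))
    (hKmc : Continuous (fun p : ℝ × ℝ => Km p.1 p.2))
    {u ut uy : ℝ → ℝ → ℝ} {up upt um umt : ℝ → ℝ}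
    (hu : Continuous fun p : ℝ × ℝ => u p.1 p.2) (hut : Continuous fun p : ℝ × ℝ => ut p.1 p.2)
    (huy : Continuous fun p : ℝ × ℝ => uy p.1 p.2)
    (hup : Continuous up) (hupt : Continuous upt) (hum : Continuous um) (humt : Continuous umt)
    (hftc : ∀ θ ∈ Icc (-π) π, ∫ y in (-L)..L, uy y θ = u L θ - u (-L) θ)
    (h1 : ∀ y ∈ Ioo (-L) L, ∀ θ ∈ Ioo (-π) π, ut y θ ≤
      (∫ θ' in (-π)..π, K y θ' (θ - θ') * u y θ') + -(V * sin θ * uy y θ)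
        - (∫ θ' in (-π)..π, K y θ (θ' - θ)) * u y θ)
    (h2 : ∀ θ ∈ Ioo (0:ℝ) π, upt θ ≤
      (∫ θ' in (0:ℝ)..π, Kp θ' (θ - θ') * up θ') + V * sin θ * u L θ
        - (∫ θ' in (-π)..π, Kp θ (θ' - θ)) * up θ)
    (h3 : ∀ θ ∈ Ioo (-π) (0:ℝ), umt θ ≤
      (∫ θ' in (-π)..(0:ℝ), Km θ' (θ - θ') * um θ') + -(V * sin θ * u (-L) θ)
        - (∫ θ' in (-π)..π, Km θ (θ' - θ)) * um θ)
    (h4 : ∀ θ ∈ Ioo (-π) (0:ℝ),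
      -(V * sin θ * u L θ) ≤ ∫ θ' in (0:ℝ)..π, Kp θ' (θ - θ') * up θ')
    (h5 : ∀ θ ∈ Ioo (0:ℝ) π,
      V * sin θ * u (-L) θ ≤ ∫ θ' in (-π)..(0:ℝ), Km θ' (θ - θ') * um θ') :
    (∫ y in (-L)..L, ∫ θ in (-π)..π, ut y θ) + (∫ θ in (0:ℝ)..π, upt θ)
      + (∫ θ in (-π)..(0:ℝ), umt θ) ≤ 0 := by
  have hpi := Real.pi_pos
  have hu1 : ∀ y, Continuous (u y) := fun y => hu.comp (f := fun x : ℝ => (y, x)) (by fun_prop)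
  have hut1 : ∀ y, Continuous (ut y) := fun y => hut.comp (f := fun x : ℝ => (y, x)) (by fun_prop)
  have huy1 : ∀ y, Continuous (uy y) := fun y => huy.comp (f := fun x : ℝ => (y, x)) (by fun_prop)
  have huy2 : ∀ x, Continuous (fun y => uy y x) :=
    fun x => huy.comp (f := fun y : ℝ => (y, x)) (by fun_prop)
  have huL := hu1 L
  have humL := hu1 (-L)
  -- interior
  have i1 : ∀ y ∈ Ioo (-L) L, ∫ θ in (-π)..π, ut y θ ≤ ∫ θ in (-π)..π, -(V * sin θ * uy y θ) := by
    intro y hy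
    have := huy1 y
    have hKy : Continuous fun p : ℝ × ℝ => K y p.1 p.2 :=
      hKc.comp (f := fun p : ℝ × ℝ => (y, p.1, p.2)) (by fun_prop)
    have := crtm_bdry (k := K y) (u := u y) (ut := ut y) (c := fun θ => -(V * sin θ * uy y θ))
      hKy (hu1 y) (hut1 y) (by fun_prop) (by linarith : -π ≤ π) (h1 y hy)
    linarith
  have i2 : ∫ y in (-L)..L, ∫ θ in (-π)..π, ut y θ
      ≤ ∫ y in (-L)..L, ∫ θ in (-π)..π, -(V * sin θ * uy y θ) := by
    apply intervalIntegral.integral_mono_on_of_le_Ioo (by linarith) _ _ i1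
    · exact (crtm_param hut _ _).intervalIntegrable _ _
    · exact (crtm_param (F := fun y θ => -(V * sin θ * uy y θ)) (by fun_prop) _ _).intervalIntegrable
        _ _
  have i3 : ∫ y in (-L)..L, ∫ θ in (-π)..π, -(V * sin θ * uy y θ)
      = ∫ θ in (-π)..π, (V * sin θ * u (-L) θ - V * sin θ * u L θ) := by
    rw [crtm_swap (F := fun y θ => -(V * sin θ * uy y θ)) (by fun_prop)]
    apply intervalIntegral.integral_congr
    intro θ hθ
    rw [uIcc_of_le (by linarith)] at hθ
    simp only [intervalIntegral.integral_neg, intervalIntegral.integral_const_mul, hftc θ hθ]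
    ring
  rw [i3, intervalIntegral.integral_sub (Continuous.intervalIntegrable (by fun_prop) _ _)
    (Continuous.intervalIntegrable (by fun_prop) _ _)] at i2
  -- boundaries
  have cG : ∀ {k : ℝ → ℝ → ℝ} {v : ℝ → ℝ}, (Continuous fun p : ℝ × ℝ => k p.1 p.2) → 
      Continuous v → ∀ a b : ℝ, Continuous fun θ => ∫ θ' in a..b, k θ' (θ - θ') * v θ' := by
    intro k v hk hv a b
    apply crtm_param (F := fun θ θ' => k θ' (θ - θ') * v θ')
    have : Continuous fun p : ℝ × ℝ => k p.2 (p.1 - p.2) := 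
      hk.comp (f := fun p : ℝ × ℝ => (p.2, p.1 - p.2)) (by fun_prop)
    fun_prop
  have cGp := cG hKpc hup 0 π
  have cGm := cG hKmc hum (-π) 0
  have b1 := crtm_bdry (c := fun θ => V * sin θ * u L θ) hKpc hup hupt (by fun_prop) hpi.le h2
  have b2 := crtm_bdry (c := fun θ => -(V * sin θ * u (-L) θ)) hKmc hum humt (by fun_prop)
    (by linarith) h3
  rw [← intervalIntegral.integral_add_adjacent_intervals (a := -π) (b := 0) (c := π)
    (cGp.intervalIntegrable _ _) (cGp.intervalIntegrable _ _)] at b1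
  rw [← intervalIntegral.integral_add_adjacent_intervals (a := -π) (b := 0) (c := π)
    (cGm.intervalIntegrable _ _) (cGm.intervalIntegrable _ _)] at b2
  have c1 := intervalIntegral.integral_mono_on_of_le_Ioo (μ := volume) (by linarith) 
    (Continuous.intervalIntegrable (by fun_prop) _ _) (cGp.intervalIntegrable _ _) h4
  have c2 := intervalIntegral.integral_mono_on_of_le_Ioo (μ := volume) (by linarith) 
    (Continuous.intervalIntegrable (by fun_prop) _ _) (cGm.intervalIntegrable _ _) h5
  rw [← intervalIntegral.integral_add_adjacent_intervals (a := -π) (b := 0) (c := π)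
    (f := fun θ => V * sin θ * u (-L) θ)
    (Continuous.intervalIntegrable (by fun_prop) _ _)
    (Continuous.intervalIntegrable (by fun_prop) _ _),
    ← intervalIntegral.integral_add_adjacent_intervals (a := -π) (b := 0) (c := π)
    (f := fun θ => V * sin θ * u L θ)
    (Continuous.intervalIntegrable (by fun_prop) _ _)
    (Continuous.intervalIntegrable (by fun_prop) _ _)] at i2
  rw [intervalIntegral.integral_neg] at b2 c1
  linarith

/-- pointwise interior inequality -/
lemma crtm_pt1 {d h w vs nt ny my k n m A B C : ℝ} (hm : m ≠ 0) (hw : w = n / m)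
    (e1 : nt + vs * ny + k * n = A) (e2 : 0 + vs * my + k * m = B)
    (j : d * (A - w * B) ≤ C - h * B) :
    d * nt ≤ C + -(vs * (d * (ny - w * my) + my * h)) - k * (m * h) := by
  have hn : n = w * m := by rw [hw]; field_simp
  subst hn
  subst e2
  have : nt = A - vs * ny - k * (w * m) := by linarith
  subst this
  nlinarith [j]

/-- pointwise boundary inequality -/
lemma crtm_pt2 {d h hL w c nt k n m nL mL A B C : ℝ} (hm : m ≠ 0) (hw : w = n / m) (hmL : mL ≠ 0)
    (e1 : nt + k * n = A + c * nL) (e2 : 0 + k * m = B + c * mL)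
    (j : d * (A - w * B) ≤ C - h * B)
    (jl : 0 ≤ c * mL * (hL - h - d * (nL / mL - w))) :
    d * nt ≤ C + c * (mL * hL) - k * (m * h) := by
  have hn : n = w * m := by rw [hw]; field_simp
  have hnL : nL = (nL / mL) * mL := by field_simp
  generalize nL / mL = q at *
  subst hn
  subst hnL
  have : B = k * m - c * mL := by linarith
  subst this
  have : nt = A + c * (q * mL) - k * (w * m) := by linarith
  subst this
  nlinarith [j, jl]

/-- The nonlinear core inequality at a fixed time. -/
lemma crtm_core {V L : ℝ} (hV : 0 < V) (hL : 0 < L)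
    {K : ℝ → ℝ → ℝ → ℝ} {Kp : ℝ → ℝ → ℝ} {Km : ℝ → ℝ → ℝ}
    (hKc : Continuous (fun p : ℝ × ℝ × ℝ => K p.1 p.2.1 p.2.2))
    (hKpc : Continuous (fun p : ℝ × ℝ => Kp p.1 p.2))
    (hKmc : Continuous (fun p : ℝ × ℝ => Km p.1 p.2))
    (hKnn : ∀ y θ z, 0 ≤ K y θ z) (hKpnn : ∀ θ z, 0 ≤ Kp θ z) (hKmnn : ∀ θ z, 0 ≤ Km θ z)
    {H : ℝ → ℝ} (hH : ContDiff ℝ 2 H) (hc : ConvexOn ℝ univ H)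
    {n nt ny m my : ℝ → ℝ → ℝ} {np npt mp nm nmt mm : ℝ → ℝ}
    (hn : Continuous fun p : ℝ × ℝ => n p.1 p.2) (hnt : Continuous fun p : ℝ × ℝ => nt p.1 p.2)
    (hny : Continuous fun p : ℝ × ℝ => ny p.1 p.2) (hm : Continuous fun p : ℝ × ℝ => m p.1 p.2)
    (hmy : Continuous fun p : ℝ × ℝ => my p.1 p.2)
    (hnp : Continuous np) (hnpt : Continuous npt) (hmp : Continuous mp)
    (hnm : Continuous nm) (hnmt : Continuous nmt) (hmm : Continuous mm)
    (m0 : ∀ y θ, 0 < m y θ) (mp0 : ∀ θ, 0 < mp θ) (mm0 : ∀ θ, 0 < mm θ)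
    (hftc : ∀ θ ∈ Icc (-π) π, ∫ y in (-L)..L, (deriv H (n y θ / m y θ) *
      (ny y θ - n y θ / m y θ * my y θ) + my y θ * H (n y θ / m y θ))
      = m L θ * H (n L θ / m L θ) - m (-L) θ * H (n (-L) θ / m (-L) θ))
    (h1 : ∀ y ∈ Ioo (-L) L, ∀ θ ∈ Ioo (-π) π,
      nt y θ + V * sin θ * ny y θ + (∫ θ' in (-π)..π, K y θ (θ' - θ)) * n y θ
      = ∫ θ' in (-π)..π, K y θ' (θ - θ') * n y θ')
    (s1 : ∀ y ∈ Ioo (-L) L, ∀ θ ∈ Ioo (-π) π,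
      0 + V * sin θ * my y θ + (∫ θ' in (-π)..π, K y θ (θ' - θ)) * m y θ
      = ∫ θ' in (-π)..π, K y θ' (θ - θ') * m y θ')
    (h2 : ∀ θ ∈ Ioo (0:ℝ) π, npt θ + (∫ θ' in (-π)..π, Kp θ (θ' - θ)) * np θ
      = (∫ θ' in (0:ℝ)..π, Kp θ' (θ - θ') * np θ') + V * sin θ * n L θ)
    (s2 : ∀ θ ∈ Ioo (0:ℝ) π, 0 + (∫ θ' in (-π)..π, Kp θ (θ' - θ)) * mp θ
      = (∫ θ' in (0:ℝ)..π, Kp θ' (θ - θ') * mp θ') + V * sin θ * m L θ)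
    (h3 : ∀ θ ∈ Ioo (-π) (0:ℝ), nmt θ + (∫ θ' in (-π)..π, Km θ (θ' - θ)) * nm θ
      = (∫ θ' in (-π)..(0:ℝ), Km θ' (θ - θ') * nm θ') - V * sin θ * n (-L) θ)
    (s3 : ∀ θ ∈ Ioo (-π) (0:ℝ), 0 + (∫ θ' in (-π)..π, Km θ (θ' - θ)) * mm θ
      = (∫ θ' in (-π)..(0:ℝ), Km θ' (θ - θ') * mm θ') - V * sin θ * m (-L) θ)
    (h4 : ∀ θ ∈ Ioo (-π) (0:ℝ),
      -(V * sin θ * n L θ) = ∫ θ' in (0:ℝ)..π, Kp θ' (θ - θ') * np θ')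
    (s4 : ∀ θ ∈ Ioo (-π) (0:ℝ),
      -(V * sin θ * m L θ) = ∫ θ' in (0:ℝ)..π, Kp θ' (θ - θ') * mp θ')
    (h5 : ∀ θ ∈ Ioo (0:ℝ) π,
      V * sin θ * n (-L) θ = ∫ θ' in (-π)..(0:ℝ), Km θ' (θ - θ') * nm θ')
    (s5 : ∀ θ ∈ Ioo (0:ℝ) π,
      V * sin θ * m (-L) θ = ∫ θ' in (-π)..(0:ℝ), Km θ' (θ - θ') * mm θ') :
    (∫ y in (-L)..L, ∫ θ in (-π)..π, deriv H (n y θ / m y θ) * nt y θ)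
      + (∫ θ in (0:ℝ)..π, deriv H (np θ / mp θ) * npt θ)
      + (∫ θ in (-π)..(0:ℝ), deriv H (nm θ / mm θ) * nmt θ) ≤ 0 := by
  have hpi := Real.pi_pos
  have hHc : Continuous H := hH.continuous
  have hH'c : Continuous (deriv H) := hH.continuous_deriv (by norm_num)
  have hq : Continuous fun p : ℝ × ℝ => n p.1 p.2 / m p.1 p.2 := hn.div hm fun _ => (m0 _ _).ne'
  have hqp : Continuous fun x => np x / mp x := hnp.div hmp fun _ => (mp0 _).ne'
  have hqm : Continuous fun x => nm x / mm x := hnm.div hmm fun _ => (mm0 _).ne'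
  have hn1 : ∀ y, Continuous (n y) := fun y => hn.comp (f := fun x : ℝ => (y, x)) (by fun_prop)
  have hm1 : ∀ y, Continuous (m y) := fun y => hm.comp (f := fun x : ℝ => (y, x)) (by fun_prop)
  have ck : ∀ θ, Continuous fun θ' => Kp θ' (θ - θ') := fun θ =>
    hKpc.comp (f := fun θ' : ℝ => (θ', θ - θ')) (by fun_prop)
  have cm : ∀ θ, Continuous fun θ' => Km θ' (θ - θ') := fun θ =>
    hKmc.comp (f := fun θ' : ℝ => (θ', θ - θ')) (by fun_prop)
  have cK : ∀ y θ, Continuous fun θ' => K y θ' (θ - θ') := fun y θ =>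
    hKc.comp (f := fun θ' : ℝ => (y, θ', θ - θ')) (by fun_prop)
  refine crtm_balance (V := V) hL hKc hKpc hKmc (u := fun y θ => m y θ * H (n y θ / m y θ))
    (uy := fun y θ => deriv H (n y θ / m y θ) *
      (ny y θ - n y θ / m y θ * my y θ) + my y θ * H (n y θ / m y θ))
    (up := fun θ => mp θ * H (np θ / mp θ)) (um := fun θ => mm θ * H (nm θ / mm θ))
    (by fun_prop) (by fun_prop) (by fun_prop) (by fun_prop) (by fun_prop) (by fun_prop)
    (by fun_prop) hftc ?_ ?_ ?_ ?_ ?_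
  · intro y hy θ hθ
    exact crtm_pt1 (m0 y θ).ne' rfl (h1 y hy θ hθ) (s1 y hy θ hθ)
      (crtm_jensen hH hc (by linarith) (cK y θ) (hn1 y) (hm1 y) (fun _ => hKnn _ _ _) (m0 y) _)
  · intro θ hθ
    refine crtm_pt2 (mp0 θ).ne' rfl (m0 L θ).ne' (h2 θ hθ) (s2 θ hθ)
      (crtm_jensen hH hc (by linarith) (ck θ) hnp hmp (fun _ => hKpnn _ _) mp0 _) ?_
    exact mul_nonneg (mul_nonneg (mul_nonneg hV.le (sin_pos_of_mem_Ioo hθ).le) (m0 L θ).le)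
      (crtm_tangent hH hc _ _)
  · intro θ hθ
    have := crtm_pt2 (c := -(V * sin θ)) (nL := n (-L) θ) (mL := m (-L) θ) 
      (hL := H (n (-L) θ / m (-L) θ))
      (mm0 θ).ne' rfl (m0 (-L) θ).ne' (by rw [h3 θ hθ]; ring) (by rw [s3 θ hθ]; ring)
      (crtm_jensen hH hc (by linarith) (cm θ) hnm hmm (fun _ => hKmnn _ _) mm0 _) 
      (mul_nonneg (mul_nonneg ?_ (m0 (-L) θ).le) (crtm_tangent hH hc _ _))
    · simp only [neg_mul] at this ⊢
      exact this
    · have := sin_neg_of_neg_of_neg_pi_lt hθ.2 hθ.1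
      nlinarith
  · intro θ hθ
    have j := crtm_jensen hH hc (w := n L θ / m L θ) hpi.le (ck θ) hnp hmp (fun _ => hKpnn _ _) mp0
    rw [← h4 θ hθ, ← s4 θ hθ] at j
    have e : n L θ / m L θ * (-(V * sin θ * m L θ)) = -(V * sin θ * n L θ) := by
      field_simp [(m0 L θ).ne']
    rw [e] at j
    nlinarith [j]
  · intro θ hθ
    have j := crtm_jensen hH hc (w := n (-L) θ / m (-L) θ) (by linarith : -π ≤ 0) (cm θ) hnm hmm
      (fun _ => hKmnn _ _) mm0
    rw [← h5 θ hθ, ← s5 θ hθ] at j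
    have e : n (-L) θ / m (-L) θ * (V * sin θ * m (-L) θ) = V * sin θ * n (-L) θ := by
      field_simp [(m0 (-L) θ).ne']
    rw [e] at j
    nlinarith [j]

def crtmCl (a b x : ℝ) : ℝ := max a (min b x)

lemma crtmCl_cont (a b : ℝ) : Continuous (crtmCl a b) := by
  unfold crtmCl; fun_prop

lemma crtmCl_mem {a b : ℝ} (h : a ≤ b) (x : ℝ) : crtmCl a b x ∈ Icc a b :=
  ⟨le_max_left _ _, max_le h (min_le_left _ _)⟩

lemma crtmCl_eq {a b x : ℝ} (h : x ∈ Icc a b) : crtmCl a b x = x := by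
  unfold crtmCl; rw [min_eq_right h.2, max_eq_right h.1]

lemma crtm_congr {a b : ℝ} (h : a ≤ b) {f g : ℝ → ℝ} (hfg : ∀ x ∈ Icc a b, f x = g x) :
    ∫ x in a..b, f x = ∫ x in a..b, g x := by
  apply intervalIntegral.integral_congr
  rw [uIcc_of_le h]; exact hfg

lemma crtm_partial {E : Type*} [NormedAddCommGroup E] [NormedSpace ℝ E] {F : E → ℝ}
    (hF : ContDiff ℝ 1 F) {g : ℝ → E} {v : E} {t : ℝ} (hg : HasDerivAt g v t) :
    HasDerivAt (fun s => F (g s)) (fderiv ℝ F (g t) v) t :=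
  ((hF.differentiable (by norm_num)) (g t)).hasFDerivAt.comp_hasDerivAt t hg

lemma crtm_pt3 {n : ℝ → ℝ → ℝ → ℝ} 
    (h : ContDiff ℝ 1 (fun p : ℝ × ℝ × ℝ => n p.1 p.2.1 p.2.2)) :
    (∀ t y θ, HasDerivAt (fun s => n s y θ) (deriv (fun s => n s y θ) t) t) ∧
    (∀ t y θ, HasDerivAt (fun z => n t z θ) (deriv (fun z => n t z θ) y) y) ∧
    (Continuous fun p : ℝ × ℝ × ℝ => deriv (fun s => n s p.2.1 p.2.2) p.1) ∧
    (Continuous fun p : ℝ × ℝ × ℝ => deriv (fun z => n p.1 z p.2.2) p.2.1) := by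
  have a1 : ∀ t y θ, HasDerivAt (fun s => n s y θ)
      (fderiv ℝ (fun p : ℝ × ℝ × ℝ => n p.1 p.2.1 p.2.2) (t, y, θ) (1, 0, 0)) t := fun t y θ =>
    crtm_partial h (g := fun s => (s, y, θ)) 
      ((hasDerivAt_id t).prodMk ((hasDerivAt_const t y).prodMk (hasDerivAt_const t θ)))
  have a2 : ∀ t y θ, HasDerivAt (fun z => n t z θ)
      (fderiv ℝ (fun p : ℝ × ℝ × ℝ => n p.1 p.2.1 p.2.2) (t, y, θ) (0, 1, 0)) y := fun t y θ =>
    crtm_partial h (g := fun z => (t, z, θ)) 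
      ((hasDerivAt_const y t).prodMk ((hasDerivAt_id y).prodMk (hasDerivAt_const y θ)))
  have hc := h.continuous_fderiv (by norm_num)
  refine ⟨fun t y θ => (a1 t y θ).differentiableAt.hasDerivAt, 
    fun t y θ => (a2 t y θ).differentiableAt.hasDerivAt, ?_, ?_⟩
  · simp_rw [fun p : ℝ × ℝ × ℝ => (a1 p.1 p.2.1 p.2.2).deriv]
    exact hc.clm_apply continuous_const
  · simp_rw [fun p : ℝ × ℝ × ℝ => (a2 p.1 p.2.1 p.2.2).deriv]
    exact hc.clm_apply continuous_const

lemma crtm_pt4 {n : ℝ → ℝ → ℝ} (h : ContDiff ℝ 1 (fun p : ℝ × ℝ => n p.1 p.2)) :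
    (∀ t θ, HasDerivAt (fun s => n s θ) (deriv (fun s => n s θ) t) t) ∧
    (Continuous fun p : ℝ × ℝ => deriv (fun s => n s p.2) p.1) := by
  have a1 : ∀ t θ, HasDerivAt (fun s => n s θ)
      (fderiv ℝ (fun p : ℝ × ℝ => n p.1 p.2) (t, θ) (1, 0)) t := fun t θ =>
    crtm_partial h (g := fun s => (s, θ)) ((hasDerivAt_id t).prodMk (hasDerivAt_const t θ))
  have hc := h.continuous_fderiv (by norm_num)
  refine ⟨fun t θ => (a1 t θ).differentiableAt.hasDerivAt, ?_⟩
  simp_rw [fun p : ℝ × ℝ => (a1 p.1 p.2).deriv]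
  exact hc.clm_apply continuous_const

lemma crtm_dH {H : ℝ → ℝ} (hH : ContDiff ℝ 2 H) {f : ℝ → ℝ} {f' t c : ℝ} (hc : c ≠ 0)
    (hf : HasDerivAt f f' t) :
    HasDerivAt (fun s => c * H (f s / c)) (deriv H (f t / c) * f') t := by
  have hd : HasDerivAt H (deriv H (f t / c)) (f t / c) := 
    ((hH.differentiable (by norm_num)) _).hasDerivAt
  have := (hd.comp t (hf.div_const c)).const_mul c
  refine this.congr_deriv ?_
  rw [mul_left_comm, mul_div_cancel₀ _ hc]

/-- **Relative entropy inequality** (inequality part of Theorem 3.1).  For a nonnegative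
classical solution `(n, n₊, n₋)` of the CRTM, a positive stationary state `(m, m₊, m₋)`
and a convex `H ∈ C²(ℝ)`, each of the seven dissipation functionals is nonpositive for
all `t ≥ 0`, and consequently the relative entropy is nonincreasing in time. -/
theorem crtm_relative_entropy_inequality
    (V L : ℝ) (hV : 0 < V) (hL : 0 < L)
    (K : ℝ → ℝ → ℝ → ℝ) (Kp : ℝ → ℝ → ℝ) (Km : ℝ → ℝ → ℝ)
    (hKc : Continuous (fun p : ℝ × ℝ × ℝ => K p.1 p.2.1 p.2.2))
    (hKpc : Continuous (fun p : ℝ × ℝ => Kp p.1 p.2))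
    (hKmc : Continuous (fun p : ℝ × ℝ => Km p.1 p.2))
    (hKnn : ∀ y θ z, 0 ≤ K y θ z)
    (hKpnn : ∀ θ z, 0 ≤ Kp θ z)
    (hKmnn : ∀ θ z, 0 ≤ Km θ z)
    (n : ℝ → ℝ → ℝ → ℝ) (np : ℝ → ℝ → ℝ) (nm : ℝ → ℝ → ℝ)
    (hsol : IsCRTMSolution V L K Kp Km n np nm)
    (hn_nn : ∀ t ≥ (0:ℝ), ∀ y ∈ Icc (-L) L, ∀ θ ∈ Icc (-π) π, 0 ≤ n t y θ)
    (hnp_nn : ∀ t ≥ (0:ℝ), ∀ θ ∈ Icc (0:ℝ) π, 0 ≤ np t θ)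
    (hnm_nn : ∀ t ≥ (0:ℝ), ∀ θ ∈ Icc (-π) (0:ℝ), 0 ≤ nm t θ)
    (m : ℝ → ℝ → ℝ) (mp : ℝ → ℝ) (mm : ℝ → ℝ)
    (hstat : IsCRTMSolution V L K Kp Km (fun _ => m) (fun _ => mp) (fun _ => mm))
    (hm_pos : ∀ y ∈ Icc (-L) L, ∀ θ ∈ Icc (-π) π, 0 < m y θ)
    (hmp_pos : ∀ θ ∈ Icc (0:ℝ) π, 0 < mp θ)
    (hmm_pos : ∀ θ ∈ Icc (-π) (0:ℝ), 0 < mm θ)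
    (H : ℝ → ℝ) (hH : ContDiff ℝ 2 H) (hHconv : ConvexOn ℝ univ H) :
    (∀ t ≥ (0:ℝ),
      D1 L K m H (fun s y θ => n s y θ / m y θ) t ≤ 0
      ∧ D1p Kp mp H (fun s θ => np s θ / mp θ) t ≤ 0
      ∧ D1m Km mm H (fun s θ => nm s θ / mm θ) t ≤ 0
      ∧ D2p V (fun θ => m L θ) H (fun s θ => n s L θ / m L θ)
          (fun s θ => np s θ / mp θ) t ≤ 0
      ∧ D2m V (fun θ => m (-L) θ) H (fun s θ => n s (-L) θ / m (-L) θ)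
          (fun s θ => nm s θ / mm θ) t ≤ 0
      ∧ D3p Kp mp H (fun s θ => np s θ / mp θ) (fun s θ => n s L θ / m L θ) t ≤ 0
      ∧ D3m Km mm H (fun s θ => nm s θ / mm θ)
          (fun s θ => n s (-L) θ / m (-L) θ) t ≤ 0)
    ∧ (∀ s t : ℝ, 0 ≤ s → s ≤ t →
        (∫ y in (-L)..L, ∫ θ in (-π)..π, m y θ * H (n t y θ / m y θ))
          + (∫ θ in (0:ℝ)..π, mp θ * H (np t θ / mp θ))
          + (∫ θ in (-π)..(0:ℝ), mm θ * H (nm t θ / mm θ))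
        ≤ (∫ y in (-L)..L, ∫ θ in (-π)..π, m y θ * H (n s y θ / m y θ))
          + (∫ θ in (0:ℝ)..π, mp θ * H (np s θ / mp θ))
          + (∫ θ in (-π)..(0:ℝ), mm θ * H (nm s θ / mm θ))) := by
  have hpi := Real.pi_pos
  have hHc : Continuous H := hH.continuous
  have hH'c : Continuous (deriv H) := hH.continuous_deriv (by norm_num)
  have mem0 : (0:ℝ) ≤ π := hpi.le
  constructor
  · intro t ht
    refine ⟨?_, ?_, ?_, ?_, ?_, ?_, ?_⟩
    · apply neg_nonpos_of_nonneg
      refine intervalIntegral.integral_nonneg (by linarith) fun y hy =>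
        intervalIntegral.integral_nonneg (by linarith) fun θ hθ =>
        intervalIntegral.integral_nonneg (by linarith) fun θ' hθ' =>
        mul_nonneg (mul_nonneg (hKnn _ _ _) (hm_pos y hy θ' hθ').le) (crtm_tangent hH hHconv _ _)
    · apply neg_nonpos_of_nonneg
      refine intervalIntegral.integral_nonneg (by linarith) fun θ hθ =>
        intervalIntegral.integral_nonneg (by linarith) fun θ' hθ' =>
        mul_nonneg (mul_nonneg (hKpnn _ _) (hmp_pos θ' hθ').le) (crtm_tangent hH hHconv _ _)
    · apply neg_nonpos_of_nonneg
      refine intervalIntegral.integral_nonneg (by linarith) fun θ hθ =>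
        intervalIntegral.integral_nonneg (by linarith) fun θ' hθ' =>
        mul_nonneg (mul_nonneg (hKmnn _ _) (hmm_pos θ' hθ').le) (crtm_tangent hH hHconv _ _)
    · apply neg_nonpos_of_nonneg
      refine intervalIntegral.integral_nonneg (by linarith) fun θ hθ =>
        mul_nonneg (mul_nonneg (mul_nonneg hV.le (sin_nonneg_of_mem_Icc hθ))
          (hm_pos L ⟨by linarith, le_rfl⟩ θ ⟨by linarith [hθ.1], hθ.2⟩).le)
          (crtm_tangent hH hHconv _ _)
    · unfold D2m
      rw [← neg_nonneg, ← intervalIntegral.integral_neg]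
      refine intervalIntegral.integral_nonneg (by linarith) fun θ hθ => ?_
      have h1 := sin_nonpos_of_nonpos_of_neg_pi_le hθ.2 hθ.1
      have h2 := hm_pos (-L) ⟨le_rfl, by linarith⟩ θ ⟨hθ.1, by linarith [hθ.2]⟩
      have h3 := crtm_tangent hH hHconv (nm t θ / mm θ) (n t (-L) θ / m (-L) θ)
      have h4 : 0 ≤ V * -sin θ * m (-L) θ := by
        apply mul_nonneg (mul_nonneg hV.le (by linarith)) h2.le
      have := mul_nonneg h4 h3
      simp only at this ⊢
      linarith
    · apply neg_nonpos_of_nonneg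
      refine intervalIntegral.integral_nonneg (by linarith) fun θ hθ =>
        intervalIntegral.integral_nonneg (by linarith) fun θ' hθ' =>
        mul_nonneg (mul_nonneg (hKpnn _ _) (hmp_pos θ' hθ').le) (crtm_tangent hH hHconv _ _)
    · apply neg_nonpos_of_nonneg
      refine intervalIntegral.integral_nonneg (by linarith) fun θ hθ =>
        intervalIntegral.integral_nonneg (by linarith) fun θ' hθ' =>
        mul_nonneg (mul_nonneg (hKmnn _ _) (hmm_pos θ' hθ').le) (crtm_tangent hH hHconv _ _)
  -- clamps
  have lL : -L ≤ L := by linarith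
  have lP : -π ≤ π := by linarith
  have lM : -π ≤ 0 := by linarith
  set c1 := crtmCl (-L) L with hc1
  set c2 := crtmCl (-π) π with hc2
  set c3 := crtmCl 0 π with hc3
  set c4 := crtmCl (-π) 0 with hc4
  have k1 : Continuous c1 := crtmCl_cont _ _
  have k2 : Continuous c2 := crtmCl_cont _ _
  have k3 : Continuous c3 := crtmCl_cont _ _
  have k4 : Continuous c4 := crtmCl_cont _ _
  have e1 : ∀ {y}, y ∈ Icc (-L) L → c1 y = y := fun h => crtmCl_eq h
  have e2 : ∀ {y}, y ∈ Icc (-π) π → c2 y = y := fun h => crtmCl_eq h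
  have e3 : ∀ {y}, y ∈ Icc 0 π → c3 y = y := fun h => crtmCl_eq h
  have e4 : ∀ {y}, y ∈ Icc (-π) 0 → c4 y = y := fun h => crtmCl_eq h
  have c1L : c1 L = L := e1 ⟨lL, le_rfl⟩
  have c1mL : c1 (-L) = -L := e1 ⟨le_rfl, lL⟩
  have m0 : ∀ y θ, 0 < m (c1 y) (c2 θ) := fun y θ =>
    hm_pos _ (crtmCl_mem lL y) _ (crtmCl_mem lP θ)
  have mp0 : ∀ θ, 0 < mp (c3 θ) := fun θ => hmp_pos _ (crtmCl_mem mem0 θ)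
  have mm0 : ∀ θ, 0 < mm (c4 θ) := fun θ => hmm_pos _ (crtmCl_mem lM θ)
  obtain ⟨dnt, dny, cnt, cny⟩ := crtm_pt3 hsol.smooth_n
  obtain ⟨-, dmy, -, cmy⟩ := crtm_pt3 (n := fun _ => m) hstat.smooth_n
  obtain ⟨dnp, cnp'⟩ := crtm_pt4 hsol.smooth_np
  obtain ⟨dnm, cnm'⟩ := crtm_pt4 hsol.smooth_nm
  have cn := hsol.smooth_n.continuous
  have cnp := hsol.smooth_np.continuous
  have cnm := hsol.smooth_nm.continuous
  have cm : Continuous fun p : ℝ × ℝ => m p.1 p.2 :=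
    hstat.smooth_n.continuous.comp (f := fun p : ℝ × ℝ => ((0:ℝ), p.1, p.2)) (by fun_prop)
  have cmp : Continuous mp :=
    hstat.smooth_np.continuous.comp (f := fun p : ℝ => ((0:ℝ), p)) (by fun_prop)
  have cmm : Continuous mm :=
    hstat.smooth_nm.continuous.comp (f := fun p : ℝ => ((0:ℝ), p)) (by fun_prop)
  -- clamped continuity, jointly in time
  have f3 : Continuous fun p : ℝ × ℝ × ℝ => (p.1, c1 p.2.1, c2 p.2.2) := by fun_prop
  have Cn : Continuous fun p : ℝ × ℝ × ℝ => n p.1 (c1 p.2.1) (c2 p.2.2) := cn.comp f3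
  have Cnt : Continuous fun p : ℝ × ℝ × ℝ =>
    deriv (fun s => n s (c1 p.2.1) (c2 p.2.2)) p.1 := cnt.comp f3
  have Cm : Continuous fun p : ℝ × ℝ => m (c1 p.1) (c2 p.2) :=
    cm.comp (f := fun p : ℝ × ℝ => (c1 p.1, c2 p.2)) (by fun_prop)
  have Cm3 : Continuous fun p : ℝ × ℝ × ℝ => m (c1 p.2.1) (c2 p.2.2) := Cm.comp continuous_snd
  have fp : Continuous fun p : ℝ × ℝ => (p.1, c3 p.2) := by fun_prop
  have fm : Continuous fun p : ℝ × ℝ => (p.1, c4 p.2) := by fun_prop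
  have Cnp : Continuous fun p : ℝ × ℝ => np p.1 (c3 p.2) := cnp.comp fp
  have Cnp' : Continuous fun p : ℝ × ℝ => deriv (fun s => np s (c3 p.2)) p.1 := cnp'.comp fp
  have Cnm : Continuous fun p : ℝ × ℝ => nm p.1 (c4 p.2) := cnm.comp fm
  have Cnm' : Continuous fun p : ℝ × ℝ => deriv (fun s => nm s (c4 p.2)) p.1 := cnm'.comp fm
  have Q : Continuous fun p : ℝ × ℝ × ℝ => n p.1 (c1 p.2.1) (c2 p.2.2) / m (c1 p.2.1) (c2 p.2.2) :=
    Cn.div Cm3 fun _ => (m0 _ _).ne'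
  have Qp : Continuous fun p : ℝ × ℝ => np p.1 (c3 p.2) / mp (c3 p.2) :=
    Cnp.div (by fun_prop) fun _ => (mp0 _).ne'
  have Qm : Continuous fun p : ℝ × ℝ => nm p.1 (c4 p.2) / mm (c4 p.2) :=
    Cnm.div (by fun_prop) fun _ => (mm0 _).ne'
  -- rewrite the entropy
  have hE : ∀ t, (∫ y in (-L)..L, ∫ θ in (-π)..π, m y θ * H (n t y θ / m y θ))
          + (∫ θ in (0:ℝ)..π, mp θ * H (np t θ / mp θ))
          + (∫ θ in (-π)..(0:ℝ), mm θ * H (nm t θ / mm θ)) =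
      (∫ y in (-L)..L, ∫ θ in (-π)..π, 
          m (c1 y) (c2 θ) * H (n t (c1 y) (c2 θ) / m (c1 y) (c2 θ)))
          + (∫ θ in (0:ℝ)..π, mp (c3 θ) * H (np t (c3 θ) / mp (c3 θ)))
          + (∫ θ in (-π)..(0:ℝ), mm (c4 θ) * H (nm t (c4 θ) / mm (c4 θ))) := by
    intro t
    congr 1
    · congr 1
      · refine crtm_congr lL fun y hy => crtm_congr lP fun θ hθ => ?_
        rw [e1 hy, e2 hθ]
      · refine crtm_congr mem0 fun θ hθ => ?_
        rw [e3 hθ]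
    · refine crtm_congr lM fun θ hθ => ?_
      rw [e4 hθ]
  have hD : ∀ t, HasDerivAt (fun t => (∫ y in (-L)..L, ∫ θ in (-π)..π, 
          m (c1 y) (c2 θ) * H (n t (c1 y) (c2 θ) / m (c1 y) (c2 θ)))
          + (∫ θ in (0:ℝ)..π, mp (c3 θ) * H (np t (c3 θ) / mp (c3 θ)))
          + (∫ θ in (-π)..(0:ℝ), mm (c4 θ) * H (nm t (c4 θ) / mm (c4 θ))))
      ((∫ y in (-L)..L, ∫ θ in (-π)..π, 
          deriv H (n t (c1 y) (c2 θ) / m (c1 y) (c2 θ)) * deriv (fun s => n s (c1 y) (c2 θ)) t)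
          + (∫ θ in (0:ℝ)..π, deriv H (np t (c3 θ) / mp (c3 θ)) * deriv (fun s => np s (c3 θ)) t)
          + (∫ θ in (-π)..(0:ℝ), deriv H (nm t (c4 θ) / mm (c4 θ)) * 
              deriv (fun s => nm s (c4 θ)) t)) t := by
    intro t
    refine ((crtm_deriv_int2 
      (F := fun t y θ => m (c1 y) (c2 θ) * H (n t (c1 y) (c2 θ) / m (c1 y) (c2 θ))) 
      (F' := fun t y θ => deriv H (n t (c1 y) (c2 θ) / m (c1 y) (c2 θ)) * 
        deriv (fun s => n s (c1 y) (c2 θ)) t) ?_ ?_ ?_ _ _ _ _ t).add 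
      (crtm_deriv_int (F := fun t θ => mp (c3 θ) * H (np t (c3 θ) / mp (c3 θ))) 
        (F' := fun t θ => deriv H (np t (c3 θ) / mp (c3 θ)) * deriv (fun s => np s (c3 θ)) t)
        ?_ ?_ ?_ _ _ t)).add 
      (crtm_deriv_int (F := fun t θ => mm (c4 θ) * H (nm t (c4 θ) / mm (c4 θ))) 
        (F' := fun t θ => deriv H (nm t (c4 θ) / mm (c4 θ)) * deriv (fun s => nm s (c4 θ)) t)
        ?_ ?_ ?_ _ _ t)
    · exact Cm3.mul (hHc.comp Q)
    · exact (hH'c.comp Q).mul Cnt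
    · intro t y θ; exact crtm_dH hH (m0 _ _).ne' (dnt _ _ _)
    · exact (cmp.comp (k3.comp continuous_snd)).mul (hHc.comp Qp)
    · exact (hH'c.comp Qp).mul Cnp'
    · intro t θ; exact crtm_dH hH (mp0 _).ne' (dnp _ _)
    · exact (cmm.comp (k4.comp continuous_snd)).mul (hHc.comp Qm)
    · exact (hH'c.comp Qm).mul Cnm'
    · intro t θ; exact crtm_dH hH (mm0 _).ne' (dnm _ _)
  have hneg : ∀ t ≥ (0:ℝ), ((∫ y in (-L)..L, ∫ θ in (-π)..π, 
          deriv H (n t (c1 y) (c2 θ) / m (c1 y) (c2 θ)) * deriv (fun s => n s (c1 y) (c2 θ)) t)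
          + (∫ θ in (0:ℝ)..π, deriv H (np t (c3 θ) / mp (c3 θ)) * deriv (fun s => np s (c3 θ)) t)
          + (∫ θ in (-π)..(0:ℝ), deriv H (nm t (c4 θ) / mm (c4 θ)) * 
              deriv (fun s => nm s (c4 θ)) t)) ≤ 0 := by
    intro t ht
    have ft : Continuous fun p : ℝ × ℝ => (t, p.1, p.2) := by fun_prop
    have ft1 : Continuous fun p : ℝ => (t, p) := by fun_prop
    have Cny : Continuous fun p : ℝ × ℝ => deriv (fun z => n t z (c2 p.2)) (c1 p.1) :=
      cny.comp (f := fun p : ℝ × ℝ => (t, c1 p.1, c2 p.2)) (by fun_prop)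
    have Cmy : Continuous fun p : ℝ × ℝ => deriv (fun z => m z (c2 p.2)) (c1 p.1) :=
      cmy.comp (f := fun p : ℝ × ℝ => (t, c1 p.1, c2 p.2)) (by fun_prop)
    have Qt : Continuous fun p : ℝ × ℝ => n t (c1 p.1) (c2 p.2) / m (c1 p.1) (c2 p.2) := Q.comp ft
    refine crtm_core (V := V) hV hL hKc hKpc hKmc hKnn hKpnn hKmnn hH hHconv
      (n := fun y θ => n t (c1 y) (c2 θ)) (nt := fun y θ => deriv (fun s => n s (c1 y) (c2 θ)) t)
      (ny := fun y θ => deriv (fun z => n t z (c2 θ)) (c1 y))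
      (m := fun y θ => m (c1 y) (c2 θ)) (my := fun y θ => deriv (fun z => m z (c2 θ)) (c1 y))
      (np := fun θ => np t (c3 θ)) (npt := fun θ => deriv (fun s => np s (c3 θ)) t)
      (nm := fun θ => nm t (c4 θ)) (nmt := fun θ => deriv (fun s => nm s (c4 θ)) t)
      (mp := fun θ => mp (c3 θ)) (mm := fun θ => mm (c4 θ))
      (Cn.comp ft) (Cnt.comp ft) Cny Cm Cmy (Cnp.comp ft1) (Cnp'.comp ft1) (cmp.comp k3)
      (Cnm.comp ft1) (Cnm'.comp ft1) (cmm.comp k4) m0 mp0 mm0 ?_ ?_ ?_ ?_ ?_ ?_ ?_ ?_ ?_ ?_ ?_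
    · intro θ hθ
      have hcont : Continuous fun y => deriv H (n t (c1 y) (c2 θ) / m (c1 y) (c2 θ)) *
          (deriv (fun z => n t z (c2 θ)) (c1 y) - n t (c1 y) (c2 θ) / m (c1 y) (c2 θ) * 
            deriv (fun z => m z (c2 θ)) (c1 y)) + deriv (fun z => m z (c2 θ)) (c1 y) * 
            H (n t (c1 y) (c2 θ) / m (c1 y) (c2 θ)) := by
        have fθ : Continuous fun y : ℝ => (y, θ) := by fun_prop
        exact ((hH'c.comp (Qt.comp fθ)).mul ((Cny.comp fθ).sub ((Qt.comp fθ).mul 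
          (Cmy.comp fθ)))).add ((Cmy.comp fθ).mul (hHc.comp (Qt.comp fθ)))
      rw [intervalIntegral.integral_eq_sub_of_hasDerivAt 
        (f := fun y => m y θ * H (n t y θ / m y θ)) ?_ (hcont.intervalIntegrable _ _)]
      · simp only [c1L, c1mL, e2 hθ]
      · intro y hy
        rw [uIcc_of_le lL] at hy
        rw [e1 hy, e2 hθ]
        have hm0 := (hm_pos y hy θ hθ).ne'
        have d1 := dny t y θ
        have d2 := dmy t y θ
        have d3 : HasDerivAt H (deriv H (n t y θ / m y θ)) (n t y θ / m y θ) := 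
          ((hH.differentiable (by norm_num)) _).hasDerivAt
        have d4 := d2.mul (d3.comp y (d1.div d2 hm0))
        refine d4.congr_deriv ?_
        simp only [Function.comp, Pi.div_apply]
        field_simp
        ring
    · intro y hy θ hθ
      have := hsol.interior_eq t ht y hy θ hθ
      rw [e1 (Ioo_subset_Icc_self hy), e2 (Ioo_subset_Icc_self hθ), this]
      exact crtm_congr lP fun x hx => by rw [e2 hx]
    · intro y hy θ hθ
      have := hstat.interior_eq t ht y hy θ hθ
      rw [deriv_const] at this
      rw [e1 (Ioo_subset_Icc_self hy), e2 (Ioo_subset_Icc_self hθ), this]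
      exact crtm_congr lP fun x hx => by rw [e2 hx]
    · intro θ hθ
      have := hsol.top_eq t ht θ hθ
      rw [c1L, e2 ⟨by linarith [hθ.1], hθ.2.le⟩, e3 (Ioo_subset_Icc_self hθ), this]
      congr 1
      exact crtm_congr mem0 fun x hx => by rw [e3 hx]
    · intro θ hθ
      have := hstat.top_eq t ht θ hθ
      rw [deriv_const] at this
      rw [c1L, e2 ⟨by linarith [hθ.1], hθ.2.le⟩, e3 (Ioo_subset_Icc_self hθ), this]
      congr 1
      exact crtm_congr mem0 fun x hx => by rw [e3 hx]
    · intro θ hθ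
      have := hsol.bot_eq t ht θ hθ
      rw [c1mL, e2 ⟨hθ.1.le, by linarith [hθ.2]⟩, e4 (Ioo_subset_Icc_self hθ), this]
      congr 1
      exact crtm_congr lM fun x hx => by rw [e4 hx]
    · intro θ hθ
      have := hstat.bot_eq t ht θ hθ
      rw [deriv_const] at this
      rw [c1mL, e2 ⟨hθ.1.le, by linarith [hθ.2]⟩, e4 (Ioo_subset_Icc_self hθ), this]
      congr 1
      exact crtm_congr lM fun x hx => by rw [e4 hx]
    · intro θ hθ
      have := hsol.bc_top t ht θ hθ
      rw [c1L, e2 ⟨hθ.1.le, by linarith [hθ.2]⟩, this]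
      exact crtm_congr mem0 fun x hx => by rw [e3 hx]
    · intro θ hθ
      have := hstat.bc_top t ht θ hθ
      rw [c1L, e2 ⟨hθ.1.le, by linarith [hθ.2]⟩, this]
      exact crtm_congr mem0 fun x hx => by rw [e3 hx]
    · intro θ hθ
      have := hsol.bc_bot t ht θ hθ
      rw [c1mL, e2 ⟨by linarith [hθ.1], hθ.2.le⟩, this]
      exact crtm_congr lM fun x hx => by rw [e4 hx]
    · intro θ hθ
      have := hstat.bc_bot t ht θ hθ
      rw [c1mL, e2 ⟨by linarith [hθ.1], hθ.2.le⟩, this]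
      exact crtm_congr lM fun x hx => by rw [e4 hx]
  intro s t hs hst
  rw [hE s, hE t]
  refine antitoneOn_of_deriv_nonpos (convex_Ici (0:ℝ)) 
    (fun x _ => (hD x).continuousAt.continuousWithinAt) 
    (fun x _ => (hD x).differentiableAt.differentiableWithinAt) ?_ hs (hs.trans hst) hst
  intro x hx
  rw [interior_Ici] at hx
  rw [(hD x).deriv]
  exact hneg x (le_of_lt hx)
end
end

section
/- Interior entropy production identity (equation (3.14) in the proof of Theorem 3.1). Let n : [0,∞)×[−L,L]×[−π,π] → ℝ be a C¹ function satisfying the interior CRTM equation (i) and the periodicity n(t,y,−π) = n(t,y,π); let m : [−L,L]×[−π,π] → (0,∞) be a C¹ function satisfying the stationary equation V sin θ ∂_y m + k(y,θ) m = ∫_{−π}^{π} K(y,θ',θ−θ') m(y,θ') dθ' with m(y,−π) = m(y,π); set ω = n/m and let H ∈ C²(ℝ). Then for all t ≥ 0, d/dt ∫_{−L}^{L}∫_{−π}^{π} m(y,θ) H(ω(t,y,θ)) dθ dy = −∫_{−π}^{π} V sin θ · m(L,θ) H(ω(t,L,θ)) dθ + ∫_{−π}^{π} V sin θ · m(−L,θ)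 H(ω(t,−L,θ)) dθ + D1(t), where D1(t) = −∫_{−L}^{L}∫_{−π}^{π}∫_{−π}^{π} K(y,θ',θ−θ') m(y,θ') [H(ω(t,y,θ')) − H(ω(t,y,θ)) − H'(ω(t,y,θ))(ω(t,y,θ') − ω(t,y,θ))] dθ' dθ dy. -/
open MeasureTheory Real Set

noncomputable section

lemma aux_swap (F : ℝ → ℝ → ℝ) (hF : Continuous (fun p : ℝ × ℝ => F p.1 p.2)) (a b c d : ℝ) :
    ∫ x in a..b, ∫ y in c..d, F x y = ∫ y in c..d, ∫ x in a..b, F x y := by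
  apply intervalIntegral_intervalIntegral_swap
  have h : IntegrableOn (Function.uncurry F) (uIcc a b ×ˢ uIcc c d) volume :=
    ContinuousOn.integrableOn_compact (isCompact_uIcc.prod isCompact_uIcc) (Continuous.continuousOn hF)
  exact h.mono_set (prod_mono uIoc_subset_uIcc uIoc_subset_uIcc)

lemma aux_deriv (F F' : ℝ → ℝ → ℝ) (hF : Continuous (fun p : ℝ × ℝ => F p.1 p.2))
    (hF' : Continuous (fun p : ℝ × ℝ => F' p.1 p.2))
    (h : ∀ s x, HasDerivAt (fun s => F s x) (F' s x) s) (a b t : ℝ) :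
    HasDerivAt (fun s => ∫ x in a..b, F s x) (∫ x in a..b, F' t x) t := by
  obtain ⟨C, hC⟩ := ((isCompact_Icc (a := t - 1) (b := t + 1)).prod
    (isCompact_uIcc (a := a) (b := b))).exists_bound_of_continuousOn hF'.continuousOn
  have c1 : ∀ s, Continuous (F s) := fun s => hF.comp (by fun_prop : Continuous fun x : ℝ => (s, x))
  have c2 : ∀ s, Continuous (F' s) := fun s => hF'.comp (by fun_prop : Continuous fun x : ℝ => (s, x))
  refine (intervalIntegral.hasDerivAt_integral_of_dominated_loc_of_deriv_le (bound := fun _ => C)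
    (s := Icc (t - 1) (t + 1)) (Icc_mem_nhds (by linarith) (by linarith)) ?_ ?_ ?_ ?_ ?_ ?_).2
  · exact Filter.Eventually.of_forall fun s => (c1 s).aestronglyMeasurable
  · exact (c1 t).intervalIntegrable _ _
  · exact (c2 t).aestronglyMeasurable
  · exact Filter.Eventually.of_forall fun x hx s hs => hC (s, x) ⟨hs, uIoc_subset_uIcc hx⟩
  · exact intervalIntegrable_const
  · exact Filter.Eventually.of_forall fun x hx s hs => h s x

lemma aux_deriv2 (G G' : ℝ → ℝ → ℝ → ℝ)
    (hG : Continuous (fun p : ℝ × ℝ × ℝ => G p.1 p.2.1 p.2.2))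
    (hG' : Continuous (fun p : ℝ × ℝ × ℝ => G' p.1 p.2.1 p.2.2))
    (h : ∀ s y x, HasDerivAt (fun s => G s y x) (G' s y x) s) (a b c d t : ℝ) :
    HasDerivAt (fun s => ∫ y in a..b, ∫ x in c..d, G s y x)
      (∫ y in a..b, ∫ x in c..d, G' t y x) t := by
  have key : ∀ G : ℝ → ℝ → ℝ → ℝ, Continuous (fun p : ℝ × ℝ × ℝ => G p.1 p.2.1 p.2.2) →
      Continuous (fun p : ℝ × ℝ => ∫ x in c..d, G p.1 p.2 x) := by
    intro G hG
    apply intervalIntegral.continuous_parametric_intervalIntegral_of_continuous'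
      (f := fun (p : ℝ × ℝ) x => G p.1 p.2 x)
    exact hG.comp (by fun_prop : Continuous fun q : (ℝ × ℝ) × ℝ => (q.1.1, q.1.2, q.2))
  refine aux_deriv (fun s y => ∫ x in c..d, G s y x) (fun s y => ∫ x in c..d, G' s y x)
    (key G hG) (key G' hG') ?_ a b t
  intro s y
  refine aux_deriv (fun s x => G s y x) (fun s x => G' s y x) ?_ ?_ (fun s x => h s y x) c d s
  · exact hG.comp (by fun_prop : Continuous fun q : ℝ × ℝ => (q.1, y, q.2))
  · exact hG'.comp (by fun_prop : Continuous fun q : ℝ × ℝ => (q.1, y, q.2))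

/-- **Interior entropy production identity** (equation (3.14) in the proof of Theorem
3.1).  If `n` is a `C¹` solution of the interior CRTM equation (i), periodic in `θ`,
and `m` is a positive `C¹` periodic solution of the stationary interior equation, then,
with `ω = n/m` and `H ∈ C²(ℝ)`,
`d/dt ∫∫ m H(ω) dθ dy = −∫ V sin θ m(L,θ) H(ω(t,L,θ)) dθ
   + ∫ V sin θ m(−L,θ) H(ω(t,−L,θ)) dθ + D1(t)`. -/
theorem crtm_interior_entropy_production
    (V L : ℝ) (hV : 0 < V) (hL : 0 < L)
    (K : ℝ → ℝ → ℝ → ℝ)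
    (hKc : Continuous (fun p : ℝ × ℝ × ℝ => K p.1 p.2.1 p.2.2))
    (hKnn : ∀ y θ z, 0 ≤ K y θ z)
    (n : ℝ → ℝ → ℝ → ℝ)
    (hn : ContDiff ℝ 1 (fun p : ℝ × ℝ × ℝ => n p.1 p.2.1 p.2.2))
    (hpde : ∀ t ≥ (0:ℝ), ∀ y ∈ Ioo (-L) L, ∀ θ ∈ Ioo (-π) π,
      deriv (fun s => n s y θ) t + V * sin θ * deriv (fun z => n t z θ) y
        + (∫ θ' in (-π)..π, K y θ (θ' - θ)) * n t y θ
        = ∫ θ' in (-π)..π, K y θ' (θ - θ') * n t y θ')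
    (hnper : ∀ t ≥ (0:ℝ), ∀ y ∈ Icc (-L) L, n t y (-π) = n t y π)
    (m : ℝ → ℝ → ℝ)
    (hm : ContDiff ℝ 1 (fun p : ℝ × ℝ => m p.1 p.2))
    (hm_pos : ∀ y ∈ Icc (-L) L, ∀ θ ∈ Icc (-π) π, 0 < m y θ)
    (hmeq : ∀ y ∈ Ioo (-L) L, ∀ θ ∈ Ioo (-π) π,
      V * sin θ * deriv (fun z => m z θ) y
        + (∫ θ' in (-π)..π, K y θ (θ' - θ)) * m y θ
        = ∫ θ' in (-π)..π, K y θ' (θ - θ') * m y θ')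
    (hmper : ∀ y ∈ Icc (-L) L, m y (-π) = m y π)
    (H : ℝ → ℝ) (hH : ContDiff ℝ 2 H) :
    ∀ t ≥ (0:ℝ),
      HasDerivAt (fun s => ∫ y in (-L)..L, ∫ θ in (-π)..π, m y θ * H (n s y θ / m y θ))
        (-(∫ θ in (-π)..π, V * sin θ * m L θ * H (n t L θ / m L θ))
          + (∫ θ in (-π)..π, V * sin θ * m (-L) θ * H (n t (-L) θ / m (-L) θ))
          + D1 L K m H (fun s y θ => n s y θ / m y θ) t) t := by
  intro t ht
  have hπ : -π ≤ π := by linarith [Real.pi_pos]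
  have hLL : -L ≤ L := by linarith
  have hnc := hn.continuous
  have hmc := hm.continuous
  have hHc := hH.continuous
  have hH1 : Continuous (deriv H) := hH.continuous_deriv (by norm_num)
  have hHd : ∀ x, HasDerivAt H (deriv H x) x := fun x =>
    (hH.differentiable (by norm_num) x).hasDerivAt
  -- clamped m
  obtain ⟨M, hMdef⟩ : ∃ M : ℝ → ℝ → ℝ, M = fun y θ =>
    m (max (-L) (min L y)) (max (-π) (min π θ)) := ⟨_, rfl⟩
  have hMc : Continuous (fun p : ℝ × ℝ => M p.1 p.2) := by
    rw [hMdef]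
    exact hmc.comp (by fun_prop : Continuous fun p : ℝ × ℝ =>
      (max (-L) (min L p.1), max (-π) (min π p.2)))
  have hMpos : ∀ y θ, 0 < M y θ := by
    intro y θ
    rw [hMdef]
    exact hm_pos _ ⟨le_max_left _ _, max_le hLL (min_le_left _ _)⟩ _
      ⟨le_max_left _ _, max_le hπ (min_le_left _ _)⟩
  have hM0 : ∀ y θ, M y θ ≠ 0 := fun y θ => (hMpos y θ).ne'
  have hMm : ∀ y ∈ Icc (-L) L, ∀ θ ∈ Icc (-π) π, M y θ = m y θ := by
    intro y hy θ hθ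
    rw [hMdef]
    simp only
    rw [min_eq_right hy.2, max_eq_right hy.1, min_eq_right hθ.2, max_eq_right hθ.1]
  -- derivatives
  obtain ⟨nt, hntc, hntd⟩ : ∃ nt : ℝ → ℝ → ℝ → ℝ,
      Continuous (fun p : ℝ × ℝ × ℝ => nt p.1 p.2.1 p.2.2) ∧
      ∀ s y θ, HasDerivAt (fun s => n s y θ) (nt s y θ) s := by
    refine ⟨fun s y θ => fderiv ℝ (fun p : ℝ × ℝ × ℝ => n p.1 p.2.1 p.2.2) (s, y, θ) (1, 0, 0),
      ?_, ?_⟩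
    · exact (hn.continuous_fderiv (by norm_num)).clm_apply continuous_const
    · intro s y θ
      have h1 := (hn.differentiable (by norm_num) (s, y, θ)).hasFDerivAt
      exact h1.comp_hasDerivAt (f := fun s : ℝ => (s, y, θ)) s
        ((hasDerivAt_id s).prodMk (hasDerivAt_const s (y, θ)))
  obtain ⟨ny, hnyc, hnyd⟩ : ∃ ny : ℝ → ℝ → ℝ,
      Continuous (fun p : ℝ × ℝ => ny p.1 p.2) ∧
      ∀ y θ, HasDerivAt (fun z => n t z θ) (ny y θ) y := by
    refine ⟨fun y θ => fderiv ℝ (fun p : ℝ × ℝ × ℝ => n p.1 p.2.1 p.2.2) (t, y, θ) (0, 1, 0),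
      ?_, ?_⟩
    · exact ((hn.continuous_fderiv (by norm_num)).comp (by fun_prop :
        Continuous fun q : ℝ × ℝ => (t, q.1, q.2))).clm_apply continuous_const
    · intro y θ
      have h1 := (hn.differentiable (by norm_num) (t, y, θ)).hasFDerivAt
      exact h1.comp_hasDerivAt (f := fun z : ℝ => (t, z, θ)) y
        ((hasDerivAt_const y t).prodMk ((hasDerivAt_id y).prodMk (hasDerivAt_const y θ)))
  obtain ⟨my, hmyc, hmyd⟩ : ∃ my : ℝ → ℝ → ℝ,
      Continuous (fun p : ℝ × ℝ => my p.1 p.2) ∧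
      ∀ y θ, HasDerivAt (fun z => m z θ) (my y θ) y := by
    refine ⟨fun y θ => fderiv ℝ (fun p : ℝ × ℝ => m p.1 p.2) (y, θ) (1, 0), ?_, ?_⟩
    · exact (hm.continuous_fderiv (by norm_num)).clm_apply continuous_const
    · intro y θ
      have h1 := (hm.differentiable (by norm_num) (y, θ)).hasFDerivAt
      exact h1.comp_hasDerivAt (f := fun z : ℝ => (z, θ)) y
        ((hasDerivAt_id y).prodMk (hasDerivAt_const y θ))
  -- composition helpers
  obtain ⟨w, hw⟩ : ∃ w : ℝ → ℝ → ℝ, w = fun y θ => n t y θ / M y θ := ⟨_, rfl⟩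
  have hnt2 : Continuous (fun p : ℝ × ℝ => n t p.1 p.2) :=
    hnc.comp (by fun_prop : Continuous fun q : ℝ × ℝ => (t, q.1, q.2))
  have hwc : Continuous (fun p : ℝ × ℝ => w p.1 p.2) := by
    rw [hw]; exact hnt2.div hMc fun p => hM0 _ _
  have hwM : ∀ y θ, M y θ * w y θ = n t y θ := by
    intro y θ; rw [hw]; field_simp [hM0 y θ]
  have sl : ∀ {F : ℝ → ℝ → ℝ}, Continuous (fun p : ℝ × ℝ => F p.1 p.2) → ∀ y, Continuous (F y) :=
    fun h y => h.comp (by fun_prop : Continuous fun x : ℝ => (y, x))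
  have pr : ∀ {F : ℝ → ℝ → ℝ → ℝ}, Continuous (fun p : (ℝ × ℝ) × ℝ => F p.1.1 p.1.2 p.2) →
      Continuous (fun p : ℝ × ℝ => ∫ x in (-π)..π, F p.1 p.2 x) := by
    intro F h
    exact intervalIntegral.continuous_parametric_intervalIntegral_of_continuous'
      (f := fun (p : ℝ × ℝ) x => F p.1 p.2 x) h _ _
  have hK1 : Continuous (fun p : (ℝ × ℝ) × ℝ => K p.1.1 p.2 (p.1.2 - p.2)) :=
    hKc.comp (by fun_prop : Continuous fun p : (ℝ × ℝ) × ℝ => (p.1.1, p.2, p.1.2 - p.2))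
  have hK2 : Continuous (fun p : (ℝ × ℝ) × ℝ => K p.1.1 p.1.2 (p.2 - p.1.2)) :=
    hKc.comp (by fun_prop : Continuous fun p : (ℝ × ℝ) × ℝ => (p.1.1, p.1.2, p.2 - p.1.2))
  have hw1 : Continuous (fun p : (ℝ × ℝ) × ℝ => w p.1.1 p.2) :=
    hwc.comp (by fun_prop : Continuous fun p : (ℝ × ℝ) × ℝ => (p.1.1, p.2))
  have hw2 : Continuous (fun p : (ℝ × ℝ) × ℝ => w p.1.1 p.1.2) :=
    hwc.comp (by fun_prop : Continuous fun p : (ℝ × ℝ) × ℝ => (p.1.1, p.1.2))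
  have hM1 : Continuous (fun p : (ℝ × ℝ) × ℝ => M p.1.1 p.2) :=
    hMc.comp (by fun_prop : Continuous fun p : (ℝ × ℝ) × ℝ => (p.1.1, p.2))
  obtain ⟨A, hA⟩ : ∃ A : ℝ → ℝ → ℝ, A = fun y θ => ∫ θ' in (-π)..π, K y θ' (θ - θ') * M y θ' *
      (H (w y θ') - H (w y θ) - deriv H (w y θ) * (w y θ' - w y θ)) := ⟨_, rfl⟩
  obtain ⟨B, hB⟩ : ∃ B : ℝ → ℝ → ℝ, B = fun y θ => ∫ θ' in (-π)..π,
      K y θ' (θ - θ') * M y θ' * H (w y θ') := ⟨_, rfl⟩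
  obtain ⟨C, hC⟩ : ∃ C : ℝ → ℝ → ℝ, C = fun y θ => (∫ θ' in (-π)..π, K y θ (θ' - θ)) *
      (M y θ * H (w y θ)) := ⟨_, rfl⟩
  obtain ⟨P, hP⟩ : ∃ P : ℝ → ℝ → ℝ, P = fun y θ => V * sin θ *
      (my y θ * H (w y θ) + deriv H (w y θ) * (ny y θ - w y θ * my y θ)) := ⟨_, rfl⟩
  have hAc : Continuous (fun p : ℝ × ℝ => A p.1 p.2) := by
    rw [hA]
    apply pr (F := fun y θ θ' => K y θ' (θ - θ') * M y θ' *
      (H (w y θ') - H (w y θ) - deriv H (w y θ) * (w y θ' - w y θ)))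
    fun_prop
  have hBc : Continuous (fun p : ℝ × ℝ => B p.1 p.2) := by
    rw [hB]
    apply pr (F := fun y θ θ' => K y θ' (θ - θ') * M y θ' * H (w y θ'))
    fun_prop
  have hCc : Continuous (fun p : ℝ × ℝ => C p.1 p.2) := by
    rw [hC]; exact (pr (F := fun y θ θ' => K y θ (θ' - θ)) hK2).mul (hMc.mul (hHc.comp hwc))
  have hPc : Continuous (fun p : ℝ × ℝ => P p.1 p.2) := by
    rw [hP]; fun_prop
  -- time derivative
  have step1 := aux_deriv2 (fun s y θ => M y θ * H (n s y θ / M y θ))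
    (fun s y θ => deriv H (n s y θ / M y θ) * nt s y θ) (by
      have h1 : Continuous (fun p : ℝ × ℝ × ℝ => M p.2.1 p.2.2) := hMc.comp continuous_snd
      exact h1.mul (hHc.comp (hnc.div h1 fun p => hM0 _ _))) (by
      have h1 : Continuous (fun p : ℝ × ℝ × ℝ => M p.2.1 p.2.2) := hMc.comp continuous_snd
      exact (hH1.comp (hnc.div h1 fun p => hM0 _ _)).mul hntc) (by
      intro s y θ
      have h1 := ((hHd (n s y θ / M y θ)).comp s ((hntd s y θ).div_const (M y θ))).const_mul (M y θ)
      refine h1.congr_deriv ?_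
      have := hM0 y θ
      field_simp) (-L) L (-π) π t
  have e0 : (fun s => ∫ y in (-L)..L, ∫ θ in (-π)..π, M y θ * H (n s y θ / M y θ)) =
      fun s => ∫ y in (-L)..L, ∫ θ in (-π)..π, m y θ * H (n s y θ / m y θ) := by
    funext s
    refine intervalIntegral.integral_congr_Ioo_of_le hLL fun y hy => ?_
    refine intervalIntegral.integral_congr_Ioo_of_le hπ fun θ hθ => ?_
    simp only [hMm y (Ioo_subset_Icc_self hy) θ (Ioo_subset_Icc_self hθ)]
  rw [e0] at step1
  refine step1.congr_deriv ?_
  -- pointwise identity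
  have point : ∀ y ∈ Ioo (-L) L, ∀ θ ∈ Ioo (-π) π,
      deriv H (n t y θ / M y θ) * nt t y θ = B y θ - C y θ - A y θ - P y θ := by
    intro y hy θ hθ
    have hy' := Ioo_subset_Icc_self hy
    have hθ' := Ioo_subset_Icc_self hθ
    have p1 := hpde t ht y hy θ hθ
    have p2 := hmeq y hy θ hθ
    rw [(hntd t y θ).deriv, (hnyd y θ).deriv] at p1
    rw [(hmyd y θ).deriv, ← hMm y hy' θ hθ'] at p2
    have eJ : ∫ θ' in (-π)..π, K y θ' (θ - θ') * m y θ' =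
        ∫ θ' in (-π)..π, K y θ' (θ - θ') * M y θ' :=
      intervalIntegral.integral_congr_Ioo_of_le hπ fun x hx => by
        simp only [hMm y hy' x (Ioo_subset_Icc_self hx)]
    rw [eJ] at p2
    have cK : Continuous fun θ' => K y θ' (θ - θ') :=
      hK1.comp (by fun_prop : Continuous fun x : ℝ => ((y, θ), x))
    have cM := sl hMc y
    have cw := sl hwc y
    have cn := sl (F := fun y θ => n t y θ) hnt2 y
    have eA : A y θ = B y θ - (H (w y θ) - deriv H (w y θ) * w y θ) *
          (∫ θ' in (-π)..π, K y θ' (θ - θ') * M y θ')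
        - deriv H (w y θ) * ∫ θ' in (-π)..π, K y θ' (θ - θ') * n t y θ' := by
      rw [hA, hB]
      simp only
      rw [← intervalIntegral.integral_const_mul, ← intervalIntegral.integral_const_mul,
        ← intervalIntegral.integral_sub, ← intervalIntegral.integral_sub]
      · congr 1
        funext x
        rw [← hwM y x]
        ring
      all_goals apply Continuous.intervalIntegrable; fun_prop
    have e1 : n t y θ / M y θ = w y θ := by rw [hw]
    rw [e1, eA, hC, hP]
    simp only
    rw [← p1, ← p2, ← hwM y θ]
    ring
  have step2 : ∫ y in (-L)..L, ∫ θ in (-π)..π, deriv H (n t y θ / M y θ) * nt t y θ =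
      ∫ y in (-L)..L, ((∫ θ in (-π)..π, B y θ) - (∫ θ in (-π)..π, C y θ)
        - (∫ θ in (-π)..π, A y θ) - ∫ θ in (-π)..π, P y θ) := by
    refine intervalIntegral.integral_congr_Ioo_of_le hLL fun y hy => ?_
    have cA := sl hAc y
    have cB := sl hBc y
    have cC := sl hCc y
    have cP := sl hPc y
    rw [← intervalIntegral.integral_sub, ← intervalIntegral.integral_sub,
      ← intervalIntegral.integral_sub]
    · exact intervalIntegral.integral_congr_Ioo_of_le hπ fun θ hθ => point y hy θ hθ
    all_goals apply Continuous.intervalIntegrable; fun_prop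
  have hBC : ∀ y, ∫ θ in (-π)..π, B y θ = ∫ θ in (-π)..π, C y θ := by
    intro y
    rw [hB, hC]
    simp only
    rw [aux_swap (fun θ θ' => K y θ' (θ - θ') * M y θ' * H (w y θ')) (by
      have h1 : Continuous fun p : ℝ × ℝ => K y p.2 (p.1 - p.2) :=
        hK1.comp (by fun_prop : Continuous fun p : ℝ × ℝ => ((y, p.1), p.2))
      have cM := sl hMc y
      have cw := sl hwc y
      fun_prop)]
    congr 1
    funext θ
    rw [← intervalIntegral.integral_mul_const]
    congr 1
    funext x
    ring
  have outer : ∀ {F : ℝ → ℝ → ℝ}, Continuous (fun p : ℝ × ℝ => F p.1 p.2) →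
      Continuous (fun y => ∫ θ in (-π)..π, F y θ) := by
    intro F h
    exact intervalIntegral.continuous_parametric_intervalIntegral_of_continuous'
      (f := F) h _ _
  have hFTC : ∫ y in (-L)..L, ∫ θ in (-π)..π, P y θ =
      (∫ θ in (-π)..π, V * sin θ * m L θ * H (n t L θ / m L θ)) -
      ∫ θ in (-π)..π, V * sin θ * m (-L) θ * H (n t (-L) θ / m (-L) θ) := by
    have bd : ∀ y ∈ Icc (-L) L, ∫ θ in (-π)..π, V * sin θ * m y θ * H (n t y θ / m y θ) =
        ∫ θ in (-π)..π, V * sin θ * M y θ * H (w y θ) := by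
      intro y hy
      refine intervalIntegral.integral_congr_Ioo_of_le hπ fun θ hθ => ?_
      simp only [hw, hMm y hy θ (Ioo_subset_Icc_self hθ)]
    rw [bd L ⟨hLL, le_rfl⟩, bd (-L) ⟨le_rfl, hLL⟩, aux_swap P hPc, ← intervalIntegral.integral_sub]
    · refine intervalIntegral.integral_congr_Ioo_of_le hπ fun θ hθ => ?_
      have hθ' := Ioo_subset_Icc_self hθ
      have cP : Continuous fun y => P y θ :=
        hPc.comp (by fun_prop : Continuous fun y : ℝ => (y, θ))
      rw [intervalIntegral.integral_eq_sub_of_hasDerivAt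
        (f := fun y => V * sin θ * m y θ * H (n t y θ / m y θ)) ?_ (cP.intervalIntegrable _ _)]
      · simp only [hw, hMm L ⟨hLL, le_rfl⟩ θ hθ', hMm (-L) ⟨le_rfl, hLL⟩ θ hθ']
      · intro y hy
        rw [uIcc_of_le hLL] at hy
        have m0 : m y θ ≠ 0 := (hm_pos y hy θ hθ').ne'
        have h1 := ((hmyd y θ).const_mul (V * sin θ)).mul
          ((hHd (n t y θ / m y θ)).comp y ((hnyd y θ).div (hmyd y θ) m0))
        refine h1.congr_deriv ?_
        simp only [hP, hw, hMm y hy θ hθ', Function.comp, Pi.div_apply]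
        field_simp
    all_goals
      apply Continuous.intervalIntegrable
      have cM := fun y => sl hMc y
      have cw := fun y => sl hwc y
      fun_prop
  have hD1 : D1 L K m H (fun s y θ => n s y θ / m y θ) t =
      -∫ y in (-L)..L, ∫ θ in (-π)..π, A y θ := by
    unfold D1
    congr 1
    refine intervalIntegral.integral_congr_Ioo_of_le hLL fun y hy => ?_
    refine intervalIntegral.integral_congr_Ioo_of_le hπ fun θ hθ => ?_
    simp only [hA]
    refine intervalIntegral.integral_congr_Ioo_of_le hπ fun x hx => ?_
    simp only [hw, hMm y (Ioo_subset_Icc_self hy) θ (Ioo_subset_Icc_self hθ),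
      hMm y (Ioo_subset_Icc_self hy) x (Ioo_subset_Icc_self hx)]
  rw [step2, hD1]
  simp only [hBC, sub_self, zero_sub]
  rw [intervalIntegral.integral_sub, intervalIntegral.integral_neg, hFTC]
  · ring
  · exact (outer hAc).neg.intervalIntegrable _ _
  · exact (outer hPc).intervalIntegrable _ _
end
end

section
/- Lower-boundary entropy production identity (equation (3.23) in the proof of Theorem 3.1). Let n₋ : [0,∞)×[−π,0] → ℝ be C¹ and n(t,−L,·) continuous on [−π,π] satisfying equation (iii) for θ ∈ (−π,0) and boundary condition (vi) for θ ∈ (0,π); let m₋ : [−π,0] → (0,∞) and m(−L,·) : [−π,π] → (0,∞) be continuous and satisfy the stationary versions of (iii) and (vi), i.e. k₋(θ) m₋(θ) = ∫_{−π}^{0} K₋(θ',θ−θ') m₋(θ') dθ' − V sin θ · m(−L,θ) for θ ∈ (−π,0) and V sin θ · m(−L,θ) = ∫_{−π}^{0} K₋(θ',θ−θ') m₋(θ') dθ' for θ ∈ (0,π). Set ω₋ = n₋/m₋ and ω₋L(t,θ) = n(t,−L,θ)/m(−L,θ), and let H ∈ C²(ℝ). Then d/dt ∫_{−π}^{0}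 m₋(θ) H(ω₋(t,θ)) dθ = D1₋(t) + D2₋(t) + D3₋(t) − ∫_{−π}^{π} V sin θ · m(−L,θ) H(ω₋L(t,θ)) dθ, where D1₋(t) = −∫_{−π}^{0}∫_{−π}^{0} K₋(θ',θ−θ') m₋(θ') [H(ω₋(t,θ')) − H(ω₋(t,θ)) − H'(ω₋(t,θ))(ω₋(t,θ') − ω₋(t,θ))] dθ' dθ, D2₋(t) = ∫_{−π}^{0} V sin θ · m(−L,θ) [H(ω₋L(t,θ)) − H(ω₋(t,θ)) − H'(ω₋(t,θ))(ω₋L(t,θ) − ω₋(t,θ))] dθ, and D3₋(t) = −∫_0^{π}∫_{−π}^{0} K₋(θ',θ−θ') m₋(θ') [H(ω₋(t,θ')) − H(ω₋L(t,θ)) − H'(ω₋L(t,θ))(ω₋(t,θ') − ω₋L(t,θ))] dθ' dθ. -/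
open MeasureTheory Real Set

noncomputable section

theorem aux_deriv_s8 (nm : ℝ → ℝ → ℝ) (hnm : ContDiff ℝ 1 (fun p : ℝ × ℝ => nm p.1 p.2))
    (M : ℝ → ℝ) (hM : Continuous M) (hMp : ∀ x, 0 < M x)
    (H : ℝ → ℝ) (hH : ContDiff ℝ 2 H) (t a b : ℝ) :
    Continuous (fun θ => deriv (fun s => nm s θ) t) ∧
    HasDerivAt (fun s => ∫ θ in a..b, M θ * H (nm s θ / M θ))
      (∫ θ in a..b, deriv H (nm t θ / M θ) * deriv (fun s => nm s θ) t) t := by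
  have hd : ∀ s θ, HasDerivAt (fun s => nm s θ)
      (fderiv ℝ (fun p : ℝ × ℝ => nm p.1 p.2) (s, θ) (1, 0)) s := by
    intro s θ
    have h1 : HasFDerivAt (fun p : ℝ × ℝ => nm p.1 p.2) _ (s, θ) :=
      (hnm.differentiable (by norm_num) (s, θ)).hasFDerivAt
    have h2 : HasDerivAt (fun s : ℝ => (s, θ)) (1, 0) s :=
      (hasDerivAt_id s).prodMk (hasDerivAt_const s θ)
    exact h1.comp_hasDerivAt s h2
  have hc : Continuous (fun p : ℝ × ℝ => deriv (fun s => nm s p.2) p.1) := by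
    have : (fun p : ℝ × ℝ => deriv (fun s => nm s p.2) p.1)
        = fun p => fderiv ℝ (fun p : ℝ × ℝ => nm p.1 p.2) p (1, 0) := by
      ext p
      exact (hd p.1 p.2).deriv
    rw [this]
    exact (hnm.continuous_fderiv (by norm_num)).clm_apply continuous_const
  have hn : Continuous (fun p : ℝ × ℝ => nm p.1 p.2) := hnm.continuous
  have hHc : Continuous H := hH.continuous
  have hHd : Continuous (deriv H) := hH.continuous_deriv (by norm_num)
  have hM0 : ∀ x, M x ≠ 0 := fun x => (hMp x).ne'
  have hq : Continuous (fun p : ℝ × ℝ => nm p.1 p.2 / M p.2) :=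
    hn.div (hM.comp continuous_snd) (fun p => hM0 p.2)
  have hF : Continuous (fun p : ℝ × ℝ => M p.2 * H (nm p.1 p.2 / M p.2)) :=
    (hM.comp continuous_snd).mul (hHc.comp hq)
  have hF' : Continuous (fun p : ℝ × ℝ =>
      deriv H (nm p.1 p.2 / M p.2) * deriv (fun s => nm s p.2) p.1) :=
    (hHd.comp hq).mul hc
  have hsec : ∀ s : ℝ, Continuous (fun θ : ℝ => (s, θ)) := fun s => by fun_prop
  refine ⟨hc.comp (hsec t), ?_⟩
  obtain ⟨C, hC⟩ := ((isCompact_Icc (a := t - 1) (b := t + 1)).prod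
    (isCompact_uIcc (a := a) (b := b))).exists_bound_of_continuousOn hF'.continuousOn
  refine (intervalIntegral.hasDerivAt_integral_of_dominated_loc_of_deriv_le
    (F := fun s θ => M θ * H (nm s θ / M θ))
    (F' := fun s θ => deriv H (nm s θ / M θ) * deriv (fun s => nm s θ) s)
    (bound := fun _ => C) (s := Icc (t - 1) (t + 1))
    (Icc_mem_nhds (by linarith) (by linarith)) ?_ ?_ ?_ ?_ ?_ ?_).2
  · exact Filter.Eventually.of_forall fun s => (hF.comp (hsec s)).aestronglyMeasurable
  · exact (hF.comp (hsec t)).intervalIntegrable _ _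
  · exact (hF'.comp (hsec t)).aestronglyMeasurable
  · exact Filter.Eventually.of_forall fun θ hθ s hs => hC (s, θ) ⟨hs, uIoc_subset_uIcc hθ⟩
  · exact intervalIntegrable_const
  · refine Filter.Eventually.of_forall fun θ _ s _ => ?_
    have h1 := (hd s θ)
    have h2 : HasDerivAt H (deriv H (nm s θ / M θ)) (nm s θ / M θ) :=
      (hH.differentiable (by norm_num) _).hasDerivAt
    have h3 := (h2.comp s (h1.div_const (M θ))).const_mul (M θ)
    have h4 : HasDerivAt (fun s => M θ * H (nm s θ / M θ)) _ s := h3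
    refine h4.congr_deriv ?_
    have h5 := hM0 θ
    simp only [h1.deriv]
    field_simp

theorem aux_alg (K : ℝ → ℝ → ℝ) (hK : Continuous (fun p : ℝ × ℝ => K p.1 p.2))
    (M w A B s wL AL BL dn : ℝ → ℝ) (hM : Continuous M) (hw : Continuous w)
    (hA : Continuous A) (hB : Continuous B) (hs : Continuous s) (hwL : Continuous wL)
    (hAL : Continuous AL) (hdn : Continuous dn)
    (h1 : ∀ θ ∈ Ioo (-π) (0:ℝ), dn θ + (∫ θ' in (-π)..π, K θ θ') * (M θ * w θ)
      = (∫ θ' in (-π)..(0:ℝ), K θ' θ * (M θ' * w θ')) - s θ * wL θ)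
    (h2 : ∀ θ ∈ Ioo (0:ℝ) π, s θ * wL θ = ∫ θ' in (-π)..(0:ℝ), K θ' θ * (M θ' * w θ'))
    (h3 : ∀ θ ∈ Ioo (-π) (0:ℝ), (∫ θ' in (-π)..π, K θ θ') * M θ
      = (∫ θ' in (-π)..(0:ℝ), K θ' θ * M θ') - s θ)
    (h4 : ∀ θ ∈ Ioo (0:ℝ) π, s θ = ∫ θ' in (-π)..(0:ℝ), K θ' θ * M θ') :
    (∫ θ in (-π)..(0:ℝ), B θ * dn θ) =
      (-∫ θ in (-π)..(0:ℝ), ∫ θ' in (-π)..(0:ℝ),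
        K θ' θ * M θ' * (A θ' - A θ - B θ * (w θ' - w θ)))
      + (∫ θ in (-π)..(0:ℝ), s θ * (AL θ - A θ - B θ * (wL θ - w θ)))
      + (-∫ θ in (0:ℝ)..π, ∫ θ' in (-π)..(0:ℝ),
        K θ' θ * M θ' * (A θ' - AL θ - BL θ * (w θ' - wL θ)))
      - ∫ θ in (-π)..π, s θ * AL θ := by
  have hpi := pi_pos
  have hKs : ∀ θ, Continuous (fun θ' => K θ' θ) := fun θ =>
    hK.comp (by fun_prop : Continuous fun θ' : ℝ => (θ', θ))
  have hsplit : ∀ θ a b x, (∫ θ' in (-π)..(0:ℝ),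
      K θ' θ * M θ' * (A θ' - a - b * (w θ' - x))) =
      (∫ θ' in (-π)..(0:ℝ), K θ' θ * M θ' * A θ')
      - a * (∫ θ' in (-π)..(0:ℝ), K θ' θ * M θ')
      - b * ((∫ θ' in (-π)..(0:ℝ), K θ' θ * (M θ' * w θ'))
        - x * ∫ θ' in (-π)..(0:ℝ), K θ' θ * M θ') := by
    intro θ a b x
    have i1 : IntervalIntegrable (fun θ' => K θ' θ * M θ' * A θ') volume (-π) 0 :=
      (((hKs θ).mul hM).mul hA).intervalIntegrable _ _
    have i2 : IntervalIntegrable (fun θ' => K θ' θ * M θ') volume (-π) 0 :=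
      ((hKs θ).mul hM).intervalIntegrable _ _
    have i3 : IntervalIntegrable (fun θ' => K θ' θ * (M θ' * w θ')) volume (-π) 0 :=
      ((hKs θ).mul (hM.mul hw)).intervalIntegrable _ _
    rw [← intervalIntegral.integral_const_mul, ← intervalIntegral.integral_const_mul,
      ← intervalIntegral.integral_sub i3 (i2.const_mul x),
      ← intervalIntegral.integral_const_mul,
      ← intervalIntegral.integral_sub i1 (i2.const_mul a),
      ← intervalIntegral.integral_sub (i1.sub (i2.const_mul a))
        ((i3.sub (i2.const_mul x)).const_mul b)]
    refine intervalIntegral.integral_congr fun θ' _ => ?_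
    ring
  have hpar : ∀ f : ℝ → ℝ → ℝ, Continuous (fun p : ℝ × ℝ => f p.1 p.2) → ∀ a b : ℝ,
      Continuous (fun θ => ∫ θ' in a..b, f θ θ') := fun f hf a b =>
    intervalIntegral.continuous_parametric_intervalIntegral_of_continuous' hf a b
  have hKM : Continuous (fun p : ℝ × ℝ => K p.2 p.1 * M p.2 * A p.2) :=
    ((hK.comp continuous_swap).mul (hM.comp continuous_snd)).mul (hA.comp continuous_snd)
  have hQ : Continuous (fun θ => ∫ θ' in (-π)..(0:ℝ), K θ' θ * M θ' * A θ') :=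
    hpar (fun θ θ' => K θ' θ * M θ' * A θ') hKM _ _
  have hk : Continuous (fun θ => ∫ θ' in (-π)..π, K θ θ') := hpar K hK _ _
  have hJ : Continuous (fun θ => ∫ θ' in (-π)..(0:ℝ), K θ' θ * M θ') :=
    hpar (fun θ θ' => K θ' θ * M θ')
      ((hK.comp continuous_swap).mul (hM.comp continuous_snd)) _ _
  have hP : Continuous (fun θ => ∫ θ' in (-π)..(0:ℝ), K θ' θ * (M θ' * w θ')) :=
    hpar (fun θ θ' => K θ' θ * (M θ' * w θ'))
      ((hK.comp continuous_swap).mul ((hM.mul hw).comp continuous_snd)) _ _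
  have hFub : (∫ θ in (-π)..π, ∫ θ' in (-π)..(0:ℝ), K θ' θ * M θ' * A θ')
      = ∫ θ in (-π)..(0:ℝ), (∫ θ' in (-π)..π, K θ θ') * M θ * A θ := by
    rw [intervalIntegral_intervalIntegral_swap]
    · refine intervalIntegral.integral_congr fun θ _ => ?_
      simp only [intervalIntegral.integral_mul_const]
    · exact (hKM.continuousOn.integrableOn_compact (isCompact_uIcc.prod isCompact_uIcc)).mono_set
        (prod_mono uIoc_subset_uIcc uIoc_subset_uIcc)
  simp only [hsplit]
  set Q := (fun θ => ∫ θ' in (-π)..(0:ℝ), K θ' θ * M θ' * A θ') with hQd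
  set k := (fun θ => ∫ θ' in (-π)..π, K θ θ') with hkd
  set J := (fun θ => ∫ θ' in (-π)..(0:ℝ), K θ' θ * M θ') with hJd
  set P := (fun θ => ∫ θ' in (-π)..(0:ℝ), K θ' θ * (M θ' * w θ')) with hPd
  change (∫ θ in (-π)..(0:ℝ), B θ * dn θ) =
      (-∫ θ in (-π)..(0:ℝ), (Q θ - A θ * J θ - B θ * (P θ - w θ * J θ)))
      + (∫ θ in (-π)..(0:ℝ), s θ * (AL θ - A θ - B θ * (wL θ - w θ)))
      + (-∫ θ in (0:ℝ)..π, (Q θ - AL θ * J θ - BL θ * (P θ - wL θ * J θ)))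
      - ∫ θ in (-π)..π, s θ * AL θ
  have e3 : (∫ θ in (0:ℝ)..π, (Q θ - AL θ * J θ - BL θ * (P θ - wL θ * J θ)))
      = ∫ θ in (0:ℝ)..π, (Q θ - s θ * AL θ) := by
    refine intervalIntegral.integral_congr_Ioo_of_le hpi.le fun θ hθ => ?_
    have a2 : s θ * wL θ = P θ := h2 θ hθ
    have a4 : s θ = J θ := h4 θ hθ
    rw [← a2, ← a4]
    ring
  have e1 : (∫ θ in (-π)..(0:ℝ), (Q θ - A θ * J θ - B θ * (P θ - w θ * J θ)))
      = ∫ θ in (-π)..(0:ℝ), (Q θ - k θ * M θ * A θ - B θ * dn θ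
        + s θ * (AL θ - A θ - B θ * (wL θ - w θ)) - s θ * AL θ) := by
    refine intervalIntegral.integral_congr_Ioo_of_le (by linarith) fun θ hθ => ?_
    have a1 : dn θ + k θ * (M θ * w θ) = P θ - s θ * wL θ := h1 θ hθ
    have a3 : k θ * M θ = J θ - s θ := h3 θ hθ
    linear_combination (A θ - B θ * w θ) * a3 + B θ * a1
  have hFub' : (∫ θ in (-π)..π, Q θ) = ∫ θ in (-π)..(0:ℝ), k θ * M θ * A θ := hFub
  have ci : ∀ {f : ℝ → ℝ}, Continuous f → ∀ a b, IntervalIntegrable f volume a b :=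
    fun hf a b => hf.intervalIntegrable a b
  have cZ : Continuous (fun θ => s θ * (AL θ - A θ - B θ * (wL θ - w θ))) :=
    hs.mul ((hAL.sub hA).sub (hB.mul (hwL.sub hw)))
  have ckM : Continuous (fun θ => k θ * M θ * A θ) := (hk.mul hM).mul hA
  have cB : Continuous (fun θ => B θ * dn θ) := hB.mul hdn
  have cs : Continuous (fun θ => s θ * AL θ) := hs.mul hAL
  have c1 : Continuous (fun θ => Q θ - k θ * M θ * A θ) := hQ.sub ckM
  have c2 : Continuous (fun θ => Q θ - k θ * M θ * A θ - B θ * dn θ) := c1.sub cB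
  have c3 : Continuous (fun θ => Q θ - k θ * M θ * A θ - B θ * dn θ
      + s θ * (AL θ - A θ - B θ * (wL θ - w θ))) := c2.add cZ
  rw [e3, e1, intervalIntegral.integral_sub (ci c3 _ _) (ci cs _ _),
    intervalIntegral.integral_add (ci c2 _ _) (ci cZ _ _),
    intervalIntegral.integral_sub (ci c1 _ _) (ci cB _ _),
    intervalIntegral.integral_sub (ci hQ _ _) (ci ckM _ _),
    intervalIntegral.integral_sub (ci hQ _ _) (ci cs _ _), ← hFub',
    ← intervalIntegral.integral_add_adjacent_intervals (ci hQ (-π) 0) (ci hQ 0 π),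
    ← intervalIntegral.integral_add_adjacent_intervals (ci cs (-π) 0) (ci cs 0 π)]
  ring

/-- **Lower-boundary entropy production identity** (equation (3.23) in the proof of
Theorem 3.1).  With `ω₋ = n₋/m₋` and `ω₋L = n(·,−L,·)/m(−L,·)`,
`d/dt ∫_{−π}^{0} m₋ H(ω₋) dθ
   = D1₋(t) + D2₋(t) + D3₋(t) − ∫_{−π}^{π} V sin θ m(−L,θ) H(ω₋L) dθ`. -/
theorem crtm_lower_boundary_entropy_production
    (V L : ℝ) (hV : 0 < V) (hL : 0 < L)
    (Km : ℝ → ℝ → ℝ)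
    (hKmc : Continuous (fun p : ℝ × ℝ => Km p.1 p.2))
    (hKmnn : ∀ θ z, 0 ≤ Km θ z)
    (nm : ℝ → ℝ → ℝ) (nL : ℝ → ℝ → ℝ)
    (hnm : ContDiff ℝ 1 (fun p : ℝ × ℝ => nm p.1 p.2))
    (hnL : ContinuousOn (fun p : ℝ × ℝ => nL p.1 p.2) (Ici 0 ×ˢ Icc (-π) π))
    (heq : ∀ t ≥ (0:ℝ), ∀ θ ∈ Ioo (-π) (0:ℝ),
      deriv (fun s => nm s θ) t + (∫ θ' in (-π)..π, Km θ (θ' - θ)) * nm t θ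
        = (∫ θ' in (-π)..(0:ℝ), Km θ' (θ - θ') * nm t θ') - V * sin θ * nL t θ)
    (hbc : ∀ t ≥ (0:ℝ), ∀ θ ∈ Ioo (0:ℝ) π,
      V * sin θ * nL t θ = ∫ θ' in (-π)..(0:ℝ), Km θ' (θ - θ') * nm t θ')
    (mm : ℝ → ℝ) (mL : ℝ → ℝ)
    (hmm : ContinuousOn mm (Icc (-π) 0)) (hmL : ContinuousOn mL (Icc (-π) π))
    (hmm_pos : ∀ θ ∈ Icc (-π) (0:ℝ), 0 < mm θ)
    (hmL_pos : ∀ θ ∈ Icc (-π) π, 0 < mL θ)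
    (hmeq : ∀ θ ∈ Ioo (-π) (0:ℝ),
      (∫ θ' in (-π)..π, Km θ (θ' - θ)) * mm θ
        = (∫ θ' in (-π)..(0:ℝ), Km θ' (θ - θ') * mm θ') - V * sin θ * mL θ)
    (hmbc : ∀ θ ∈ Ioo (0:ℝ) π,
      V * sin θ * mL θ = ∫ θ' in (-π)..(0:ℝ), Km θ' (θ - θ') * mm θ')
    (H : ℝ → ℝ) (hH : ContDiff ℝ 2 H) :
    ∀ t ≥ (0:ℝ),
      HasDerivAt (fun s => ∫ θ in (-π)..(0:ℝ), mm θ * H (nm s θ / mm θ))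
        (D1m Km mm H (fun s θ => nm s θ / mm θ) t
          + D2m V mL H (fun s θ => nL s θ / mL θ) (fun s θ => nm s θ / mm θ) t
          + D3m Km mm H (fun s θ => nm s θ / mm θ) (fun s θ => nL s θ / mL θ) t
          - ∫ θ in (-π)..π, V * sin θ * mL θ * H (nL t θ / mL θ)) t := by
  intro t ht
  have hpi := pi_pos
  have hle0 : -π ≤ 0 := by linarith
  have hlep : -π ≤ π := by linarith
  -- continuous extensions
  obtain ⟨M, hM, hMp, hMe⟩ : ∃ M : ℝ → ℝ, Continuous M ∧ (∀ x, 0 < M x) ∧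
      ∀ x ∈ Icc (-π) (0:ℝ), mm x = M x :=
    ⟨IccExtend hle0 ((Icc (-π) 0).domRestrict mm), hmm.domRestrict.Icc_extend',
      fun x => hmm_pos _ (projIcc (-π) 0 hle0 x).2,
      fun x hx => by rw [IccExtend_of_mem _ _ hx]; rfl⟩
  obtain ⟨ML, hML, hMLp, hMLe⟩ : ∃ M : ℝ → ℝ, Continuous M ∧ (∀ x, 0 < M x) ∧
      ∀ x ∈ Icc (-π) π, mL x = M x :=
    ⟨IccExtend hlep ((Icc (-π) π).domRestrict mL), hmL.domRestrict.Icc_extend',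
      fun x => hmL_pos _ (projIcc (-π) π hlep x).2,
      fun x hx => by rw [IccExtend_of_mem _ _ hx]; rfl⟩
  have hnLt : ContinuousOn (nL t) (Icc (-π) π) :=
    hnL.comp (by fun_prop : ContinuousOn (fun θ : ℝ => (t, θ)) (Icc (-π) π))
      (fun θ hθ => ⟨ht, hθ⟩)
  obtain ⟨N, hN, hNe⟩ : ∃ N : ℝ → ℝ, Continuous N ∧ ∀ x ∈ Icc (-π) π, nL t x = N x :=
    ⟨IccExtend hlep ((Icc (-π) π).domRestrict (nL t)), hnLt.domRestrict.Icc_extend',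
      fun x hx => by rw [IccExtend_of_mem _ _ hx]; rfl⟩
  have u0 : uIcc (-π) (0:ℝ) = Icc (-π) 0 := uIcc_of_le hle0
  have up : uIcc (-π) π = Icc (-π) π := uIcc_of_le hlep
  have u0p : uIcc 0 π = Icc 0 π := uIcc_of_le hpi.le
  have s0 : Icc (-π) (0:ℝ) ⊆ Icc (-π) π := Icc_subset_Icc_right hpi.le
  have s1 : Icc (0:ℝ) π ⊆ Icc (-π) π := Icc_subset_Icc_left hle0
  obtain ⟨hdnc, hder⟩ := aux_deriv_s8 nm hnm M hM hMp H hH t (-π) 0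
  have hnt : Continuous (nm t) :=
    hnm.continuous.comp (by fun_prop : Continuous fun θ : ℝ => (t, θ))
  have hw : Continuous (fun θ => nm t θ / M θ) := hnt.div hM fun x => (hMp x).ne'
  have hwL : Continuous (fun θ => N θ / ML θ) := hN.div hML fun x => (hMLp x).ne'
  have hHc : Continuous H := hH.continuous
  have hHd : Continuous (deriv H) := hH.continuous_deriv (by norm_num)
  have cM : ∀ θ, M θ * (nm t θ / M θ) = nm t θ := fun θ => mul_div_cancel₀ _ (hMp θ).ne'
  have cML : ∀ θ, V * sin θ * ML θ * (N θ / ML θ) = V * sin θ * N θ := fun θ => by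
    rw [mul_assoc (V * sin θ), mul_div_cancel₀ _ (hMLp θ).ne']
  have hmi : ∀ θ, (∫ θ' in (-π)..(0:ℝ), Km θ' (θ - θ') * mm θ')
      = ∫ θ' in (-π)..(0:ℝ), Km θ' (θ - θ') * M θ' := fun θ =>
    intervalIntegral.integral_congr fun θ' h => by
      rw [u0] at h; simp only [hMe θ' h]
  have key := aux_alg (fun a b => Km a (b - a))
    (hKmc.comp (by fun_prop : Continuous fun p : ℝ × ℝ => (p.1, p.2 - p.1)))
    M (fun θ => nm t θ / M θ) (fun θ => H (nm t θ / M θ)) (fun θ => deriv H (nm t θ / M θ))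
    (fun θ => V * sin θ * ML θ) (fun θ => N θ / ML θ) (fun θ => H (N θ / ML θ))
    (fun θ => deriv H (N θ / ML θ)) (fun θ => deriv (fun s => nm s θ) t)
    hM hw (hHc.comp hw) (hHd.comp hw) ((continuous_const.mul continuous_sin).mul hML) hwL
    (hHc.comp hwL) hdnc
    (fun θ hθ => by
      simp only [cM, cML]
      rw [← hNe θ (s0 (Ioo_subset_Icc_self hθ))]
      exact heq t ht θ hθ)
    (fun θ hθ => by
      simp only [cM, cML]
      rw [← hNe θ (s1 (Ioo_subset_Icc_self hθ))]
      exact hbc t ht θ hθ)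
    (fun θ hθ => by
      rw [← hmi, ← hMe θ (Ioo_subset_Icc_self hθ), ← hMLe θ (s0 (Ioo_subset_Icc_self hθ))]
      exact hmeq θ hθ)
    (fun θ hθ => by
      rw [← hmi, ← hMLe θ (s1 (Ioo_subset_Icc_self hθ))]
      exact hmbc θ hθ)
  have hfun : (fun s => ∫ θ in (-π)..(0:ℝ), mm θ * H (nm s θ / mm θ))
      = fun s => ∫ θ in (-π)..(0:ℝ), M θ * H (nm s θ / M θ) := by
    funext s
    refine intervalIntegral.integral_congr fun θ h => ?_
    rw [u0] at h
    simp only [hMe θ h]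
  rw [hfun]
  rw [key] at hder
  convert hder using 1
  unfold D1m D2m D3m
  congr 1
  · congr 1
    · congr 1
      · congr 1
        refine intervalIntegral.integral_congr fun θ h => ?_
        refine intervalIntegral.integral_congr fun θ' h' => ?_
        rw [u0] at h h'
        simp only [hMe θ h, hMe θ' h']
      · refine intervalIntegral.integral_congr fun θ h => ?_
        rw [u0] at h
        simp only [hMe θ h, hMLe θ (s0 h), hNe θ (s0 h)]
    · congr 1
      refine intervalIntegral.integral_congr fun θ h => ?_
      refine intervalIntegral.integral_congr fun θ' h' => ?_
      rw [u0] at h'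
      rw [u0p] at h
      simp only [hMe θ' h', hMLe θ (s1 h), hNe θ (s1 h)]
  · refine intervalIntegral.integral_congr fun θ h => ?_
    rw [up] at h
    simp only [hMLe θ h, hNe θ h]
end
end
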